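/- arXiv:math/0506088 — 2 statements merged into one kernel-verified Lean document; each statement's English description precedes it below -/
import Mathlib

section
/- Let π : K[ X(A,B) ((A,B) ∈ H_p), Y(I) (I ∈ H_u), Z(J) (J ∈ H_ξ) ] → K[X]^{SL_n(K)} be the surjective K-algebra homomorphism defined by X(A,B) ↦ p(A,B), Y(I) ↦ u(I), Z(J) ↦ ξ(J). Then ker π is generated by the following quadratic elements: (i) Y(I)Z(J) − X(I,J) for all I ∈ H_u, J ∈ H_ξ; and (ii) for each noncomparable pair of elements α, β of H with {α,β} not of the form {I, J} with I ∈ H_u, J ∈ H_ξ, an element x_α x_β − Σ_i c_i x_{α_i} x_{β_i} (where x_γ denotes the variable corresponding to γ ∈ H), with c_i ∈ K∖{0}, finitely many terms, and α_i ⪰ β_i in H for every i (with the convention that when the straightening produces the empty minor, the corresponding factor is omitted, i.e. replaced by 1). (Second fundamental theorem for SL_n(K)-invariants / presentation of the invariant ring.) -/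
namespace SMB

/-- `geTup f g` : the strictly increasing tuple `f` is `≥` the strictly increasing tuple `g`
in the order on increasing tuples: the length of `f` is at most that of `g`, and `f` is
entrywise `≥` `g` (on the common range of indices). -/
def geTup {N s s' : ℕ} (f : Fin s → Fin N) (g : Fin s' → Fin N) : Prop :=
  ∃ h : s ≤ s', ∀ j : Fin s, g (Fin.castLE h j) ≤ f j

/-- A strictly increasing `s`-tuple with values in `{1,…,N}` (encoded as `Fin N`). -/
structure IncTup (s N : ℕ) where
  f : Fin s → Fin N
  mono : StrictMono f

/-- A pair of strictly increasing tuples of a common length `s`: row indices in `{1,…,m}`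
and column indices in `{1,…,q}`, indexing an `s × s` minor. -/
structure PairIx (m q : ℕ) where
  s : ℕ
  rows : Fin s → Fin m
  cols : Fin s → Fin q
  rmono : StrictMono rows
  cmono : StrictMono cols

/-- The partial order `(A,B) ⪰ (A',B')` on pairs of increasing tuples: `A ≥ A'` and `B ≥ B'`. -/
def PairIx.ge {m q : ℕ} (x y : PairIx m q) : Prop :=
  geTup x.rows y.rows ∧ geTup x.cols y.cols

end SMB
namespace SMB

variable (K : Type) [Field K] (n m q : ℕ)

/-- The coordinate ring `K[X]` of `X = M_{m,n}(K) × M_{n,q}(K)`: the polynomial ring over `K`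
in the entries of a generic `m×n` matrix `U` and a generic `n×q` matrix `W`. -/
abbrev KX := MvPolynomial ((Fin m × Fin n) ⊕ (Fin n × Fin q)) K

/-- The generic `m×n` matrix `U = (u_{ij})`. -/
noncomputable def Ugen : Matrix (Fin m) (Fin n) (KX K n m q) :=
  Matrix.of fun i j => MvPolynomial.X (Sum.inl (i, j))

/-- The generic `n×q` matrix `W = (ξ_{kl})`. -/
noncomputable def Wgen : Matrix (Fin n) (Fin q) (KX K n m q) :=
  Matrix.of fun k l => MvPolynomial.X (Sum.inr (k, l))

/-- `φ_{ij}`, the `(i,j)` entry of the product matrix `UW`. -/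
noncomputable def phi (i : Fin m) (j : Fin q) : KX K n m q :=
  (Ugen K n m q * Wgen K n m q) i j

/-- Evaluation of a polynomial in `K[X]` at a point `(U, W) ∈ X`. -/
noncomputable def evalX (U : Matrix (Fin m) (Fin n) K) (W : Matrix (Fin n) (Fin q) K) :
    KX K n m q →+* K :=
  MvPolynomial.eval (Sum.elim (fun p => U p.1 p.2) (fun p => W p.1 p.2))

variable {K n m q}

/-- `f ∈ K[X]` is invariant under the diagonal action of `GL_n(K)`:
`f(UA, A⁻¹W) = f(U, W)` for all `A ∈ GL_n(K)` and all `(U,W) ∈ X`. -/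
def IsGLInvariant (f : KX K n m q) : Prop :=
  ∀ (A : GL (Fin n) K) (U : Matrix (Fin m) (Fin n) K) (W : Matrix (Fin n) (Fin q) K),
    evalX K n m q (U * (A : Matrix (Fin n) (Fin n) K))
      (((A⁻¹ : GL (Fin n) K) : Matrix (Fin n) (Fin n) K) * W) f = evalX K n m q U W f

/-- `f ∈ K[X]` is invariant under the diagonal action of `SL_n(K)`:
`f(UA, A⁻¹W) = f(U, W)` for all `A ∈ SL_n(K)` and all `(U,W) ∈ X`. -/
def IsSLInvariant (f : KX K n m q) : Prop :=
  ∀ (A : Matrix.SpecialLinearGroup (Fin n) K)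
    (U : Matrix (Fin m) (Fin n) K) (W : Matrix (Fin n) (Fin q) K),
    evalX K n m q (U * (A : Matrix (Fin n) (Fin n) K))
      (((A⁻¹ : Matrix.SpecialLinearGroup (Fin n) K) : Matrix (Fin n) (Fin n) K) * W) f
      = evalX K n m q U W f

variable (K n m q)

end SMB
namespace SMB

variable (K : Type) [Field K] (n m q : ℕ)

/-- `p(A,B)`: the minor of the product matrix `UW` with row indices `A` and column indices `B`. -/
noncomputable def pPoly (x : PairIx m q) : KX K n m q :=
  Matrix.det (Matrix.of fun i j : Fin x.s =>
    (Ugen K n m q * Wgen K n m q) (x.rows i) (x.cols j))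

/-- `u(I)`: the maximal (`n×n`) minor of `U` with row indices `I`. -/
noncomputable def uPoly (I : Fin n → Fin m) : KX K n m q :=
  Matrix.det (Matrix.of fun i j : Fin n => MvPolynomial.X (Sum.inl (I i, j)))

/-- `ξ(J)`: the maximal (`n×n`) minor of `W` with column indices `J`. -/
noncomputable def xiPoly (J : Fin n → Fin q) : KX K n m q :=
  Matrix.det (Matrix.of fun i j : Fin n => MvPolynomial.X (Sum.inr (i, J j)))

end SMB
namespace SMB

variable (n m q : ℕ)

/-- The index set `H = H_u ⊔ H_ξ ⊔ H_p`, where `H_u = I(n,m)`, `H_ξ = I(n,q)` and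
`H_p = ⋃_{1 ≤ r ≤ n} I(r,m) × I(r,q)`. -/
abbrev HElt := IncTup n m ⊕ (IncTup n q ⊕ {x : PairIx m q // 0 < x.s ∧ x.s ≤ n})

variable {n m q}

/-- The partial order on `H`: componentwise order on `H_u` and on `H_ξ`; the order `⪰` on
`H_p`; elements of `H_u` and `H_ξ` mutually incomparable; no element of `H_u ∪ H_ξ` above
any element of `H_p`; `I ≤ (A,B)` iff `I ≤ A`, and `J ≤ (A,B)` iff `J ≤ B`. -/
def hle : HElt n m q → HElt n m q → Prop
  | Sum.inl I, Sum.inl I' => ∀ j, I.f j ≤ I'.f j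
  | Sum.inl I, Sum.inr (Sum.inr P) => geTup P.val.rows I.f
  | Sum.inr (Sum.inl J), Sum.inr (Sum.inl J') => ∀ j, J.f j ≤ J'.f j
  | Sum.inr (Sum.inl J), Sum.inr (Sum.inr P) => geTup P.val.cols J.f
  | Sum.inr (Sum.inr P), Sum.inr (Sum.inr P') => PairIx.ge P'.val P.val
  | _, _ => False

end SMB
namespace SMB

variable (K : Type) [Field K] (n m q : ℕ)

/-- The regular function on `X` attached to an element of `H`:
`u(I)` for `I ∈ H_u`, `ξ(J)` for `J ∈ H_ξ`, and `p(A,B)` for `(A,B) ∈ H_p`. -/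
noncomputable def polyOf : HElt n m q → KX K n m q
  | Sum.inl I => uPoly K n m q I.f
  | Sum.inr (Sum.inl J) => xiPoly K n m q J.f
  | Sum.inr (Sum.inr P) => pPoly K n m q P.val

variable {n m q}

/-- A list of elements of `H` indexes a standard monomial iff it does not involve both some
`u(I)` and some `ξ(J)`, and it is weakly decreasing for the partial order on `H`. -/
def IsStandardList (L : List (HElt n m q)) : Prop :=
  (¬ ((∃ I : IncTup n m, Sum.inl I ∈ L) ∧
      (∃ J : IncTup n q, Sum.inr (Sum.inl J) ∈ L))) ∧
  L.Chain' fun a b => hle b a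

end SMB

namespace SMB

variable (K : Type) [Field K] (n m q : ℕ)

/-- The `K`-algebra homomorphism
`π : K[X(A,B), Y(I), Z(J)] → K[X]`, `X(A,B) ↦ p(A,B)`, `Y(I) ↦ u(I)`, `Z(J) ↦ ξ(J)`
(its image is the ring of invariants `K[X]^{SL_n(K)}`). -/
noncomputable def piSL : MvPolynomial (HElt n m q) K →ₐ[K] KX K n m q :=
  MvPolynomial.aeval (polyOf K n m q)

variable {n m q}

/-- The element `(I,J)` of `H_p` attached to `I ∈ H_u` and `J ∈ H_ξ`. -/
def pairOfUXi (hn : 0 < n) (I : IncTup n m) (J : IncTup n q) : HElt n m q :=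
  Sum.inr (Sum.inr ⟨⟨n, I.f, J.f, I.mono, J.mono⟩, hn, le_refl n⟩)

/-- `α, β` is (up to order) a pair consisting of an element of `H_u` and one of `H_ξ`. -/
def isUXiPair (α β : HElt n m q) : Prop :=
  (∃ (I : IncTup n m) (J : IncTup n q), α = Sum.inl I ∧ β = Sum.inr (Sum.inl J)) ∨
  (∃ (I : IncTup n m) (J : IncTup n q), β = Sum.inl I ∧ α = Sum.inr (Sum.inl J))

/-- A quadratic straightening element for the noncomparable pair `α, β` of `H`:
`x_α x_β − Σᵢ cᵢ x_{αᵢ} x_{βᵢ}` with nonzero coefficients and `αᵢ ⪰ βᵢ` for every `i`;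
a summand may omit its first factor (the case of the empty minor, i.e. the factor `1`,
encoded by `none`). -/
def SLStraightElt (α β : HElt n m q) (F : MvPolynomial (HElt n m q) K) : Prop :=
  ∃ (T : Finset (Option (HElt n m q) × HElt n m q)) (c : Option (HElt n m q) × HElt n m q → K),
    F = MvPolynomial.X α * MvPolynomial.X β -
        ∑ s ∈ T, c s • ((s.1.elim 1 fun γ => MvPolynomial.X γ) * MvPolynomial.X s.2) ∧
    ∀ s ∈ T, c s ≠ 0 ∧ ∀ γ : HElt n m q, s.1 = some γ → hle s.2 γ

end SMB

namespace SMB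
open MvPolynomial

theorem le_sum_degreeOf_of_coeff_prod_ne_zero {σ K : Type*} [Fintype σ] [Field K]
    (θ : σ → MvPolynomial σ K) (N M : σ →₀ ℕ) (h : coeff M (∏ s, θ s ^ N s) ≠ 0) (t : σ) :
    M t ≤ ∑ s, N s * degreeOf t (θ s) := by
  classical
  refine (monomial_le_degreeOf t (mem_support_iff.2 h)).trans ?_
  refine (degreeOf_prod_le t _ _).trans (Finset.sum_le_sum fun s _ => ?_)
  exact degreeOf_pow_le t _ _

theorem apply_le_of_coeff_prod_ne_zero {σ K : Type*} [Fintype σ] [Field K]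
    (θ : σ → MvPolynomial σ K) (N M : σ →₀ ℕ) (h : coeff M (∏ s, θ s ^ N s) ≠ 0) (t t' : σ)
    (h0 : ∀ s, s ≠ t' → degreeOf t (θ s) = 0) (h1 : degreeOf t (θ t') ≤ 1) : M t ≤ N t' := by
  classical
  refine (le_sum_degreeOf_of_coeff_prod_ne_zero θ N M h t).trans ?_
  rw [Finset.sum_eq_single t']
  · exact (Nat.mul_le_mul_left _ h1).trans (by simp)
  · intro s _ hs
    simp [h0 s hs]
  · simp

theorem apply_eq_of_coeff_prod_ne_zero {σ K : Type*} [Fintype σ] [Field K]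
    (θ : σ → MvPolynomial σ K) (N M : σ →₀ ℕ) (h : coeff M (∏ s, θ s ^ N s) ≠ 0) (t : σ)
    (ht : θ t = X t) (h0 : ∀ s, s ≠ t → degreeOf t (θ s) = 0) : M t = N t := by
  classical
  have h1 : ∀ s, degreeOf t (θ s) ≤ if s = t then 1 else 0 := by
    intro s
    split_ifs with hs
    · subst hs; rw [ht, degreeOf_X_self]
    · exact (h0 s hs).le
  refine le_antisymm (apply_le_of_coeff_prod_ne_zero θ N M h t t h0 (by simpa using h1 t)) ?_
  by_contra hlt
  apply h
  rw [← Finset.mul_prod_erase _ _ (Finset.mem_univ t), ht, X_pow_eq_monomial,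
    coeff_monomial_mul', if_neg]
  intro hle
  have := hle t
  simp only [Finsupp.single_eq_same] at this
  exact hlt this

end SMB

namespace SMB
open MvPolynomial

theorem exists_monomialOrder_single_lt {σ : Type} [Fintype σ] (P : σ → Prop) :
    ∃ mo : MonomialOrder.{0, 0} σ, ∀ a b, ¬ P a → P b →
      mo.toSyn (Finsupp.single a 1) < mo.toSyn (Finsupp.single b 1) := by
  classical
  let e := Fintype.equivFin σ
  let r : σ → Bool ×ₗ Fin (Fintype.card σ) := fun s => toLex (decide (¬ P s), e s)
  have hr : Function.Injective r := by
    intro a b hab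
    have := congrArg (fun z => (ofLex z).2) hab
    exact e.injective this
  let _ : LinearOrder σ := LinearOrder.lift' r hr
  refine ⟨MonomialOrder.lex, fun a b ha hb => ?_⟩
  have hlt : b < a := by
    change r b < r a
    rw [Prod.Lex.lt_iff]
    left
    simp [r, ha, hb]
  exact MonomialOrder.lex_lt_iff.2 (Finsupp.Lex.single_lt_iff.2 hlt)

theorem coeff_prod_pow_ne_zero {σ τ K : Type*} [Fintype σ] [Field K] (mo : MonomialOrder τ)
    (θ : σ → MvPolynomial τ K) (N : σ → ℕ) (h0 : ∀ s, θ s ≠ 0) :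
    coeff (∑ s, N s • mo.degree (θ s)) (∏ s, θ s ^ N s) ≠ 0 := by
  have h : ∀ s, mo.degree (θ s ^ N s) = N s • mo.degree (θ s) := fun s => mo.degree_pow _ _
  simp_rw [← h]
  rw [mo.coeff_prod_sum_degree]
  refine Finset.prod_ne_zero_iff.2 fun s _ => ?_
  rw [mo.leadingCoeff_ne_zero_iff]
  exact pow_ne_zero _ (h0 s)

theorem degree_C_mul_X_add_X {σ K : Type*} [Field K] (mo : MonomialOrder σ) (a b : σ)
    (hab : mo.toSyn (Finsupp.single a 1) < mo.toSyn (Finsupp.single b 1)) (ε : K) (hε : ε ≠ 0) :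
    mo.degree (C ε * (X a + X b) : MvPolynomial σ K) = Finsupp.single b 1 ∧
      (C ε * (X a + X b) : MvPolynomial σ K) ≠ 0 := by
  have h1 : mo.degree (X a + X b : MvPolynomial σ K) = Finsupp.single b 1 := by
    rw [add_comm, mo.degree_add_of_lt, mo.degree_X]
    simpa [mo.degree_X] using hab
  have hne : (X a + X b : MvPolynomial σ K) ≠ 0 := by
    intro h
    rw [h, mo.degree_zero] at h1
    exact Finsupp.single_ne_zero.2 one_ne_zero h1.symm
  refine ⟨?_, mul_ne_zero (by simpa using hε) hne⟩
  rw [mo.degree_mul (by simpa using hε) hne, h1, mo.degree_C, zero_add]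

theorem coeff_aeval_eq_sum {σ τ K : Type*} [Fintype σ] [Field K]
    (θ : σ → MvPolynomial τ K) (f : MvPolynomial σ K) (M : τ →₀ ℕ) :
    coeff M (aeval θ f) = ∑ N ∈ f.support, coeff N f * coeff M (∏ s, θ s ^ N s) := by
  rw [aeval_def, eval₂_eq', coeff_sum]
  refine Finset.sum_congr rfl fun N _ => ?_
  rw [algebraMap_eq, coeff_C_mul]

end SMB

namespace SMB
open MvPolynomial

section Shear

variable {σ ι K : Type} [Field K] (y : ι × Bool → σ) (ε : ι → K) (lo : ι → Prop) (v : ι)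

open Classical in
/-- The substitution of the upper entries used to compare coefficients along a shear. -/
noncomputable def shearR : σ → MvPolynomial σ K :=
  Function.extend y (fun p =>
    if lo p.1 then X (y p)
    else if p.1 = v then (if p.2 then C (ε p.1) else 1)
    else if p.2 then C (ε p.1) * (X (y (p.1, false)) + X (y (p.1, true)))
    else X (y p)) X

open Classical in
/-- The image of `shearR` under the shear. -/
noncomputable def shearL : σ → MvPolynomial σ K :=
  Function.extend y (fun p =>
    if lo p.1 then (if p.2 then X (y p) else X (y p) - C (ε p.1) * X (y (p.1, true)))
    else if p.1 = v then (if p.2 then C (ε p.1) else 0)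
    else if p.2 then C (ε p.1) * (X (y (p.1, false)) + X (y (p.1, true)))
    else - X (y (p.1, true))) X

theorem shearL_eq (hy : Function.Injective y) (hε : ∀ i, ε i * ε i = 1) (hv : ¬ lo v) (i : ι) :
    shearL y ε lo v (y (i, false)) = shearR y ε lo v (y (i, false)) -
      C (ε i) * shearR y ε lo v (y (i, true)) := by
  have hC : (C (ε i) * C (ε i) : MvPolynomial σ K) = 1 := by rw [← C_mul, hε, C_1]
  unfold shearL shearR
  simp only [hy.extend_apply]
  by_cases h1 : lo i
  · simp [h1]
  · by_cases h2 : i = v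
    · subst h2
      simp [h1, hC]
    · simp only [h1, h2, if_false, if_true, Bool.false_eq_true]
      rw [← mul_assoc, hC]; ring

theorem shearL_of_ne (hy : Function.Injective y) (s : σ) (hs : ∀ i, s ≠ y (i, false)) :
    shearL y ε lo v s = shearR y ε lo v s := by
  unfold shearL shearR
  by_cases h : ∃ p, y p = s
  · obtain ⟨⟨i, b⟩, rfl⟩ := h
    simp only [hy.extend_apply]
    cases b with
    | false => exact absurd rfl (hs i)
    | true => simp
  · rw [Function.extend_apply' _ _ _ h, Function.extend_apply' _ _ _ h]

theorem degreeOf_C_mul_X_add_X_eq_zero {t a b : σ} (ha : t ≠ a) (hb : t ≠ b) (e : K) :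
    degreeOf t (C e * (X a + X b) : MvPolynomial σ K) = 0 := by
  refine Nat.le_zero.1 ((degreeOf_C_mul_le _ _ _).trans ((degreeOf_add_le _ _ _).trans ?_))
  rw [degreeOf_X_of_ne ha, degreeOf_X_of_ne hb, max_self]

theorem degreeOf_C_mul_X_add_X_le (t a b : σ) (e : K) :
    degreeOf t (C e * (X a + X b) : MvPolynomial σ K) ≤ 1 := by
  classical
  refine (degreeOf_C_mul_le _ _ _).trans ((degreeOf_add_le _ _ _).trans ?_)
  rw [degreeOf_X, degreeOf_X]
  split_ifs <;> simp

theorem degreeOf_X_sub_C_mul_X_eq_zero {t a b : σ} (ha : t ≠ a) (hb : t ≠ b) (e : K) :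
    degreeOf t (X a - C e * X b : MvPolynomial σ K) = 0 := by
  refine Nat.le_zero.1 ((degreeOf_sub_le _ _ _).trans ?_)
  rw [degreeOf_X_of_ne ha]
  have := (degreeOf_C_mul_le (X b : MvPolynomial σ K) t e)
  rw [degreeOf_X_of_ne hb] at this
  simpa using this

theorem degreeOf_X_sub_C_mul_X_le (t a b : σ) (e : K) :
    degreeOf t (X a - C e * X b : MvPolynomial σ K) ≤ 1 := by
  classical
  refine (degreeOf_sub_le _ _ _).trans (max_le ?_ ((degreeOf_C_mul_le _ _ _).trans ?_)) <;>
  · rw [degreeOf_X]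
    split_ifs <;> simp

theorem shearR_of_lo (hy : Function.Injective y) {t : σ}
    (ht : ∀ i b, t = y (i, b) → lo i) : shearR y ε lo v t = X t := by
  unfold shearR
  by_cases h : ∃ p, y p = t
  · obtain ⟨⟨i, b⟩, rfl⟩ := h
    rw [hy.extend_apply, if_pos (ht i b rfl)]
  · rw [Function.extend_apply' _ _ _ h]

theorem degreeOf_shearR_of_lo (hy : Function.Injective y) {t : σ}
    (ht : ∀ i b, t = y (i, b) → lo i) {s : σ} (hs : s ≠ t) :
    degreeOf t (shearR y ε lo v s) = 0 := by
  unfold shearR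
  by_cases h : ∃ p, y p = s
  · obtain ⟨⟨i, b⟩, rfl⟩ := h
    rw [hy.extend_apply]
    dsimp only
    split_ifs with h1 h2 h3 h3
    · exact degreeOf_X_of_ne hs.symm
    · exact degreeOf_C _ _
    · exact degreeOf_one _
    · exact degreeOf_C_mul_X_add_X_eq_zero (fun h => h1 (ht _ _ h)) (fun h => h1 (ht _ _ h)) _
    · exact degreeOf_X_of_ne hs.symm
  · rw [Function.extend_apply' _ _ _ h]
    exact degreeOf_X_of_ne hs.symm

theorem degreeOf_shearR_of_hi (hy : Function.Injective y) (i : ι) {s : σ}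
    (hs : s ≠ y (i, true)) : degreeOf (y (i, true)) (shearR y ε lo v s) = 0 := by
  unfold shearR
  by_cases h : ∃ p, y p = s
  · obtain ⟨⟨j, b⟩, rfl⟩ := h
    rw [hy.extend_apply]
    dsimp only
    split_ifs with h1 h2 h3 h3
    · exact degreeOf_X_of_ne hs.symm
    · exact degreeOf_C _ _
    · exact degreeOf_one _
    · subst h3
      exact degreeOf_C_mul_X_add_X_eq_zero (fun h => by simpa using hy h) hs.symm _
    · exact degreeOf_X_of_ne hs.symm
  · rw [Function.extend_apply' _ _ _ h]
    exact degreeOf_X_of_ne hs.symm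

theorem degreeOf_shearR_le (hy : Function.Injective y) (t s : σ) :
    degreeOf t (shearR y ε lo v s) ≤ 1 := by
  classical
  have hX : ∀ a : σ, degreeOf t (X a : MvPolynomial σ K) ≤ 1 := by
    intro a; rw [degreeOf_X]; split_ifs <;> simp
  unfold shearR
  by_cases h : ∃ p, y p = s
  · obtain ⟨⟨j, b⟩, rfl⟩ := h
    rw [hy.extend_apply]
    dsimp only
    split_ifs with h1 h2 h3 h3
    · exact hX _
    · simp [degreeOf_C]
    · simp [degreeOf_one]
    · exact degreeOf_C_mul_X_add_X_le _ _ _ _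
    · exact hX _
  · rw [Function.extend_apply' _ _ _ h]
    exact hX _

theorem shearL_of_not_range {t : σ} (ht : ∀ p, t ≠ y p) : shearL y ε lo v t = X t := by
  unfold shearL
  rw [Function.extend_apply' _ _ _ (fun ⟨p, hp⟩ => ht p hp.symm)]

theorem degreeOf_neg_X_le (t a : σ) : degreeOf t (-X a : MvPolynomial σ K) ≤ 1 := by
  classical
  rw [degreeOf_neg, degreeOf_X]
  split_ifs <;> simp

theorem degreeOf_shearL_of_not_range (hy : Function.Injective y) {t : σ} (ht : ∀ p, t ≠ y p)
    {s : σ} (hs : s ≠ t) : degreeOf t (shearL y ε lo v s) = 0 := by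
  unfold shearL
  by_cases h : ∃ p, y p = s
  · obtain ⟨⟨i, b⟩, rfl⟩ := h
    rw [hy.extend_apply]
    dsimp only
    split_ifs with h1 h2 h2 h3 h3
    · exact degreeOf_X_of_ne hs.symm
    · exact degreeOf_X_sub_C_mul_X_eq_zero hs.symm (ht _) _
    · exact degreeOf_C _ _
    · exact degreeOf_zero _
    · exact degreeOf_C_mul_X_add_X_eq_zero (ht _) (ht _) _
    · rw [degreeOf_neg]
      exact degreeOf_X_of_ne (ht _)
  · rw [Function.extend_apply' _ _ _ h]
    exact degreeOf_X_of_ne hs.symm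

theorem degreeOf_shearL_of_lo (hy : Function.Injective y) {i : ι} (hi : lo i)
    {s : σ} (hs : s ≠ y (i, false)) : degreeOf (y (i, false)) (shearL y ε lo v s) = 0 := by
  unfold shearL
  by_cases h : ∃ p, y p = s
  · obtain ⟨⟨j, b⟩, rfl⟩ := h
    rw [hy.extend_apply]
    dsimp only
    have hj : ∀ j, (y (i, false)) ≠ y (j, true) := fun j h => by simpa using hy h
    split_ifs with h1 h2 h2 h3 h3
    · exact degreeOf_X_of_ne hs.symm
    · exact degreeOf_X_sub_C_mul_X_eq_zero hs.symm (hj _) _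
    · exact degreeOf_C _ _
    · exact degreeOf_zero _
    · refine degreeOf_C_mul_X_add_X_eq_zero (fun h => h1 ?_) (hj _) _
      have := hy h
      simp only [Prod.mk.injEq, and_true] at this
      exact this ▸ hi
    · rw [degreeOf_neg]
      exact degreeOf_X_of_ne (hj _)
  · rw [Function.extend_apply' _ _ _ h]
    exact degreeOf_X_of_ne hs.symm

theorem degreeOf_shearL_of_hi (hy : Function.Injective y) {i : ι} (hi : ¬ lo i)
    {s : σ} (hs : s ≠ y (i, true)) : degreeOf (y (i, false)) (shearL y ε lo v s) = 0 := by
  have hj : ∀ j, (y (i, false)) ≠ y (j, true) := fun j h => by simpa using hy h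
  by_cases h : ∃ p, y p = s
  · obtain ⟨⟨j, b⟩, rfl⟩ := h
    unfold shearL
    rw [hy.extend_apply]
    dsimp only
    split_ifs with h1 h2 h2 h3 h3
    · subst h2
      exact degreeOf_X_of_ne (hj _)
    · refine degreeOf_X_sub_C_mul_X_eq_zero (fun h => hi ?_) (hj _) _
      obtain rfl : i = j := congrArg Prod.fst (hy h)
      exact h1
    · exact degreeOf_C _ _
    · exact degreeOf_zero _
    · subst h3
      refine degreeOf_C_mul_X_add_X_eq_zero (fun h => hs ?_) (hj _) _
      have := congrArg Prod.fst (hy h)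
      simp only at this
      rw [this]
    · rw [degreeOf_neg]
      exact degreeOf_X_of_ne (hj _)
  · have h' : ∀ p, s ≠ y p := fun p hp => h ⟨p, hp.symm⟩
    rw [shearL_of_not_range y ε lo v h']
    exact degreeOf_X_of_ne (h' _).symm

theorem degreeOf_shearL_le (hy : Function.Injective y) (t s : σ) :
    degreeOf t (shearL y ε lo v s) ≤ 1 := by
  classical
  have hX : ∀ a : σ, degreeOf t (X a : MvPolynomial σ K) ≤ 1 := by
    intro a; rw [degreeOf_X]; split_ifs <;> simp
  unfold shearL
  by_cases h : ∃ p, y p = s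
  · obtain ⟨⟨j, b⟩, rfl⟩ := h
    rw [hy.extend_apply]
    dsimp only
    split_ifs with h1 h2 h2 h3 h3
    · exact hX _
    · exact degreeOf_X_sub_C_mul_X_le _ _ _ _
    · simp [degreeOf_C]
    · simp
    · exact degreeOf_C_mul_X_add_X_le _ _ _ _
    · exact degreeOf_neg_X_le _ _
  · rw [Function.extend_apply' _ _ _ h]
    exact hX _

theorem shearL_pivot (hy : Function.Injective y) (hv : ¬ lo v) :
    shearL y ε lo v (y (v, false)) = 0 := by
  unfold shearL
  rw [hy.extend_apply]
  simp [hv]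

open Classical in
theorem degree_shearR (hy : Function.Injective y) (hv : ¬ lo v) (hε : ∀ i, ε i ≠ 0)
    (mo : MonomialOrder σ)
    (hmo : ∀ i, mo.toSyn (Finsupp.single (y (i, false)) 1) <
      mo.toSyn (Finsupp.single (y (i, true)) 1)) (s : σ) :
    mo.degree (shearR y ε lo v s) =
      (if s = y (v, false) ∨ s = y (v, true) then 0 else Finsupp.single s 1) ∧
    shearR y ε lo v s ≠ 0 := by
  by_cases h : ∃ p, y p = s
  · obtain ⟨⟨j, b⟩, rfl⟩ := h
    unfold shearR
    rw [hy.extend_apply]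
    dsimp only
    by_cases hj : j = v
    · subst hj
      cases b <;> simp [hv, hε, mo.degree_C]
    · have : ¬ (y (j, b) = y (v, false) ∨ y (j, b) = y (v, true)) := by
        rintro (h | h)
        · exact hj (congrArg Prod.fst (hy h))
        · exact hj (congrArg Prod.fst (hy h))
      rw [if_neg this, if_neg hj]
      split_ifs with h1 h2
      · simp [mo.degree_X]
      · subst h2
        exact degree_C_mul_X_add_X mo _ _ (hmo j) _ (hε j)
      · simp [mo.degree_X]
  · have h' : ∀ p, s ≠ y p := fun p hp => h ⟨p, hp.symm⟩
    rw [if_neg (not_or.2 ⟨h' _, h' _⟩), shearR_of_lo y ε lo v hy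
      (fun i b hh => absurd hh (h' _))]
    simp [mo.degree_X]

end Shear

end SMB

namespace SMB
open MvPolynomial

/-- Shear invariance bounds the exponents of a monomial that is extremal for the given pivot. -/
theorem pivot_le_of_shear_invariant {σ ι K : Type} [Field K] [Fintype σ] [Fintype ι]
    (y : ι × Bool → σ) (hy : Function.Injective y) (ε : ι → K) (hε : ∀ i, ε i * ε i = 1)
    (lo : ι → Prop) [DecidablePred lo] (v : ι) (hv : ¬ lo v) (f : MvPolynomial σ K) (M : σ →₀ ℕ)
    (hM : M ∈ f.support)
    (inv : ∀ θ θ' : σ → MvPolynomial σ K,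
      (∀ i, θ' (y (i, false)) = θ (y (i, false)) - C (ε i) * θ (y (i, true))) →
      (∀ s, (∀ i, s ≠ y (i, false)) → θ' s = θ s) → aeval θ' f = aeval θ f)
    (hc : ∀ N ∈ f.support, (∀ s, (∀ p, s ≠ y p) → N s = M s) →
      ∀ i, N (y (i, false)) + N (y (i, true)) = M (y (i, false)) + M (y (i, true)))
    (ht : ∀ N ∈ f.support, ∑ i, N (y (i, false)) = ∑ i, N (y (i, true)))
    (H : ∀ N ∈ f.support, (∀ s, (∀ p, s ≠ y p) → N s = M s) →
      (∀ i, lo i → M (y (i, false)) ≤ N (y (i, false))) →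
      (∀ i, lo i → N (y (i, false)) = M (y (i, false))) ∧
        N (y (v, false)) ≤ M (y (v, false))) :
    M (y (v, true)) + ∑ i with lo i, M (y (i, true)) ≤ ∑ i with lo i, M (y (i, false)) := by
  classical
  have hε0 : ∀ i, ε i ≠ 0 := fun i h => by simpa [h] using hε i
  set M' : σ →₀ ℕ := ∑ s, M s • (if s = y (v, false) ∨ s = y (v, true) then 0
    else Finsupp.single s 1) with hM'
  have hM'0 : ∀ s, M' s = if s = y (v, false) ∨ s = y (v, true) then 0 else M s := by
    intro s
    rw [hM', Finsupp.finsetSum_apply, Finset.sum_eq_single s]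
    · split_ifs <;> simp
    · intro b _ hb
      split_ifs
      · simp
      · simp [hb]
    · simp
  have hM'y : ∀ i b, i ≠ v → M' (y (i, b)) = M (y (i, b)) := by
    intro i b hi
    rw [hM'0, if_neg]
    rintro (h | h)
    · exact hi (congrArg Prod.fst (hy h))
    · exact hi (congrArg Prod.fst (hy h))
  have hM'n : ∀ s, (∀ p, s ≠ y p) → M' s = M s := by
    intro s hs
    rw [hM'0, if_neg (not_or.2 ⟨hs _, hs _⟩)]
  have hlov : ∀ i, lo i → i ≠ v := fun i hi h => hv (h ▸ hi)
  -- the coefficient of `M'` on the `R` side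
  have hR : ∀ N ∈ f.support, coeff M' (∏ s, shearR y ε lo v s ^ N s) ≠ 0 → N = M := by
    intro N hN hne
    have h1 : ∀ s, (∀ i b, s = y (i, b) → lo i) → M' s = N s := fun s hs =>
      apply_eq_of_coeff_prod_ne_zero _ N M' hne s (shearR_of_lo y ε lo v hy hs)
        fun s' hs' => degreeOf_shearR_of_lo y ε lo v hy hs hs'
    have h2 : ∀ s, (∀ p, s ≠ y p) → N s = M s := fun s hs => by
      rw [← h1 s (fun i b h => absurd h (hs _)), hM'n s hs]
    have h3 : ∀ i, lo i → N (y (i, false)) = M (y (i, false)) := fun i hi => by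
      rw [← h1 (y (i, false)), hM'y i _ (hlov i hi)]
      intro j b h
      obtain rfl : i = j := congrArg Prod.fst (hy h)
      exact hi
    have h4 := (H N hN h2 (fun i hi => (h3 i hi).ge)).2
    have h5 : ∀ i, ¬ lo i → i ≠ v → M (y (i, true)) ≤ N (y (i, true)) := fun i _ hi => by
      rw [← hM'y i _ hi]
      exact apply_le_of_coeff_prod_ne_zero _ N M' hne _ _
        (fun s hs => degreeOf_shearR_of_hi y ε lo v hy i hs) (degreeOf_shearR_le y ε lo v hy _ _)
    have hcN := hc N hN h2
    have h6 : ∀ i ∈ Finset.univ, N (y (i, false)) ≤ M (y (i, false)) := by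
      intro i _
      by_cases hi : lo i
      · exact (h3 i hi).le
      · by_cases hiv : i = v
        · subst hiv; exact h4
        · have := h5 i hi hiv
          have := hcN i
          omega
    have h7 : ∑ i, N (y (i, false)) = ∑ i, M (y (i, false)) := by
      have e1 := ht N hN
      have e2 := ht M hM
      have e3 : ∑ i, N (y (i, false)) + ∑ i, N (y (i, true)) =
          ∑ i, M (y (i, false)) + ∑ i, M (y (i, true)) := by
        rw [← Finset.sum_add_distrib, ← Finset.sum_add_distrib]
        exact Finset.sum_congr rfl fun i _ => hcN i
      omega
    have h8 := (Finset.sum_eq_sum_iff_of_le h6).1 h7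
    ext s
    by_cases h : ∃ p, y p = s
    · obtain ⟨⟨i, b⟩, rfl⟩ := h
      have e1 := h8 i (Finset.mem_univ i)
      have e2 := hcN i
      cases b
      · exact e1
      · omega
    · exact h2 s fun p hp => h ⟨p, hp.symm⟩
  have hRne : coeff M' (aeval (shearR y ε lo v) f) ≠ 0 := by
    rw [coeff_aeval_eq_sum, Finset.sum_eq_single M]
    · refine mul_ne_zero (mem_support_iff.1 hM) ?_
      obtain ⟨mo, hmo⟩ := exists_monomialOrder_single_lt (fun s => ∃ i, s = y (i, true))
      have hdeg := degree_shearR y ε lo v hy hv hε0 mo (fun i => hmo _ _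
        (by rintro ⟨j, hj⟩; simpa using hy hj) ⟨i, rfl⟩)
      have := coeff_prod_pow_ne_zero mo (shearR y ε lo v) M (fun s => (hdeg s).2)
      simp_rw [fun s => (hdeg s).1] at this
      exact this
    · intro N hN hNM
      by_contra hne
      exact hNM (hR N hN (right_ne_zero_of_mul hne))
    · intro h; exact absurd hM h
  rw [← inv (shearR y ε lo v) (shearL y ε lo v) (shearL_eq y ε lo v hy hε hv)
    (shearL_of_ne y ε lo v hy), coeff_aeval_eq_sum] at hRne
  obtain ⟨N, hN, hne⟩ := Finset.exists_ne_zero_of_sum_ne_zero hRne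
  replace hne := right_ne_zero_of_mul hne
  have h2 : ∀ s, (∀ p, s ≠ y p) → N s = M s := fun s hs => by
    rw [← hM'n s hs]
    exact (apply_eq_of_coeff_prod_ne_zero _ N M' hne s (shearL_of_not_range y ε lo v hs)
      fun s' hs' => degreeOf_shearL_of_not_range y ε lo v hy hs hs').symm
  have h3 : ∀ i, lo i → M (y (i, false)) ≤ N (y (i, false)) := fun i hi => by
    rw [← hM'y i _ (hlov i hi)]
    exact apply_le_of_coeff_prod_ne_zero _ N M' hne _ _
      (fun s hs => degreeOf_shearL_of_lo y ε lo v hy hi hs) (degreeOf_shearL_le y ε lo v hy _ _)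
  have h3' := (H N hN h2 h3).1
  have h4 : N (y (v, false)) = 0 := by
    by_contra h0
    apply hne
    rw [Finset.prod_eq_zero (Finset.mem_univ (y (v, false))), coeff_zero]
    rw [shearL_pivot y ε lo v hy hv, zero_pow h0]
  have h5 : ∀ i, ¬ lo i → i ≠ v → M (y (i, false)) ≤ N (y (i, true)) := fun i hi hiv => by
    rw [← hM'y i _ hiv]
    exact apply_le_of_coeff_prod_ne_zero _ N M' hne _ _
      (fun s hs => degreeOf_shearL_of_hi y ε lo v hy hi hs) (degreeOf_shearL_le y ε lo v hy _ _)
  have hcN := hc N hN h2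
  have e1 := ht N hN
  have e2 := ht M hM
  -- split the sums over `lo`, `v` and the rest
  have split : ∀ g : ι → ℕ, ∑ i, g i = ∑ i with lo i, g i + (g v + ∑ i with (¬ lo i ∧ i ≠ v), g i) := by
    intro g
    rw [← Finset.sum_filter_add_sum_filter_not Finset.univ lo]
    congr 1
    rw [← Finset.add_sum_erase _ _ (a := v) (by simp [hv])]
    congr 1
    refine Finset.sum_congr ?_ fun _ _ => rfl
    ext i
    simp [and_comm]
  have s1 : ∑ i with (¬ lo i ∧ i ≠ v), M (y (i, false)) ≤
      ∑ i with (¬ lo i ∧ i ≠ v), N (y (i, true)) :=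
    Finset.sum_le_sum fun i hi => by
      simp only [Finset.mem_filter, Finset.mem_univ, true_and] at hi
      exact h5 i hi.1 hi.2
  have s2 : ∑ i with lo i, N (y (i, false)) = ∑ i with lo i, M (y (i, false)) :=
    Finset.sum_congr rfl fun i hi => h3' i (by simpa using hi)
  have s3 : ∀ p : Finset ι, ∑ i ∈ p, N (y (i, false)) + ∑ i ∈ p, N (y (i, true)) =
      ∑ i ∈ p, M (y (i, false)) + ∑ i ∈ p, M (y (i, true)) := by
    intro p
    rw [← Finset.sum_add_distrib, ← Finset.sum_add_distrib]
    exact Finset.sum_congr rfl fun i _ => hcN i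
  have s4 := s3 {i | lo i}
  have s5 := s3 {i | ¬ lo i ∧ i ≠ v}
  have s6 := hcN v
  rw [split (fun i => N (y (i, false))), split (fun i => N (y (i, true)))] at e1
  rw [split (fun i => M (y (i, false))), split (fun i => M (y (i, true)))] at e2
  omega

end SMB

set_option linter.unusedSimpArgs false
namespace SMB
open MvPolynomial

/-- The variables of the coordinate ring `KX`. -/
abbrev Var (n m q : ℕ) := (Fin m × Fin n) ⊕ (Fin n × Fin q)

section LexOfRank

variable {σ α : Type} [Finite σ] [LinearOrder α]

/-- The lexicographic monomial order in which variables of smaller rank are larger. -/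
noncomputable def lexOfRank (r : σ → α) (hr : Function.Injective r) : MonomialOrder.{0, 0} σ :=
  let _ : LinearOrder σ := LinearOrder.lift' r hr
  MonomialOrder.lex

theorem lexOfRank_lt_iff (r : σ → α) (hr : Function.Injective r) {N M : σ →₀ ℕ} :
    (lexOfRank r hr).toSyn N < (lexOfRank r hr).toSyn M ↔
      ∃ t, (∀ s, r s < r t → N s = M s) ∧ N t < M t := by
  let _ : LinearOrder σ := LinearOrder.lift' r hr
  exact Finsupp.Lex.lt_iff

end LexOfRank

section Order

variable {n m q : ℕ}

/-- Rank of a variable; variables of smaller rank are larger in the monomial order. -/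
def rk : Var n m q → ℕ ×ₗ ℕ
  | Sum.inl (i, j) => toLex (j.1, i.1)
  | Sum.inr (j, l) => toLex (2 * n - j.1, q - l.1)

theorem rk_injective : Function.Injective (rk : Var n m q → ℕ ×ₗ ℕ) := by
  rintro (⟨i, j⟩ | ⟨j, l⟩) (⟨i', j'⟩ | ⟨j', l'⟩) h <;>
  · have h1 := congrArg (fun z => (ofLex z).1) h
    have h2 := congrArg (fun z => (ofLex z).2) h
    simp only [rk, ofLex_toLex] at h1 h2
    have := j.2
    have := j'.2
    first
    | (exfalso; omega)
    | (congr 2 <;> ext <;> omega)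

/-- The lexicographic monomial order on the variables attached to `rk`. -/
noncomputable def ord : MonomialOrder.{0, 0} (Var n m q) := lexOfRank rk rk_injective

theorem ord_lt_iff {N M : Var n m q →₀ ℕ} :
    ord.toSyn N < ord.toSyn M ↔ ∃ t, (∀ s, rk s < rk t → N s = M s) ∧ N t < M t :=
  lexOfRank_lt_iff rk rk_injective

theorem rk_lt_iff (s t : Var n m q) : rk s < rk t ↔
    (ofLex (rk s)).1 < (ofLex (rk t)).1 ∨
      ((ofLex (rk s)).1 = (ofLex (rk t)).1 ∧ (ofLex (rk s)).2 < (ofLex (rk t)).2) :=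
  Prod.Lex.lt_iff

theorem ord_le_cases {N M : Var n m q →₀ ℕ} (h : ord.toSyn N ≤ ord.toSyn M) :
    N = M ∨ ∃ t, (∀ s, rk s < rk t → N s = M s) ∧ N t < M t := by
  rcases h.lt_or_eq with h | h
  · exact Or.inr (ord_lt_iff.1 h)
  · exact Or.inl (ord.toSyn.injective h)

/-- The pairs of variables affected by the shear moving column `j'` to column `j`. -/
def shearVar (j j' : Fin n) : (Fin m ⊕ Fin q) × Bool → Var n m q
  | (Sum.inl i, b) => Sum.inl (i, if b then j' else j)
  | (Sum.inr l, b) => Sum.inr (if b then j else j', l)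

/-- The signs of the shear. -/
def shearSign (K : Type) [Field K] : Fin m ⊕ Fin q → K
  | Sum.inl _ => 1
  | Sum.inr _ => -1

theorem shearVar_injective {j j' : Fin n} (h : j ≠ j') :
    Function.Injective (shearVar j j' : (Fin m ⊕ Fin q) × Bool → Var n m q) := by
  rintro ⟨i | l, _ | _⟩ ⟨i' | l', _ | _⟩ <;> simp [shearVar, h, h.symm]

/-- Torus weight, row content and column content of the variables. -/
def varWt : Var n m q → (Fin n → ℤ) × (Fin m → ℕ) × (Fin q → ℕ)
  | Sum.inl (i, j) => (Pi.single j 1, Pi.single i 1, 0)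
  | Sum.inr (j, l) => (-Pi.single j 1, 0, Pi.single l 1)

theorem weight_varWt_torus (N : Var n m q →₀ ℕ) (j : Fin n) :
    (Finsupp.weight varWt N).1 j = ∑ i, (N (Sum.inl (i, j)) : ℤ) - ∑ l, (N (Sum.inr (j, l)) : ℤ) := by
  rw [Finsupp.weight_eq_sum]
  simp only [Fintype.sum_sum_type, Fintype.sum_prod_type, varWt, Prod.fst_add, Prod.smul_fst,
    Prod.fst_sum, Pi.add_apply, Finset.sum_apply, Pi.smul_apply, Pi.neg_apply, Pi.single_apply,
    smul_neg, Finset.sum_neg_distrib, nsmul_eq_mul, mul_ite, mul_one, mul_zero]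
  rw [sub_eq_add_neg]
  congr 1
  · simp [Pi.single_apply]
  · rw [Finset.sum_comm]
    simp [Pi.single_apply]

theorem weight_varWt_row (N : Var n m q →₀ ℕ) (i : Fin m) :
    (Finsupp.weight varWt N).2.1 i = ∑ j, N (Sum.inl (i, j)) := by
  rw [Finsupp.weight_eq_sum]
  simp only [Fintype.sum_sum_type, Fintype.sum_prod_type, varWt, Prod.smul_mk, Prod.fst_add,
    Prod.snd_add, Prod.snd_sum,
    Prod.fst_sum, Pi.add_apply, Finset.sum_apply, Pi.smul_apply, Pi.zero_apply, Pi.single_apply,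
    smul_eq_mul, mul_ite, mul_one, mul_zero, smul_zero, Finset.sum_const_zero, add_zero]
  rw [Finset.sum_comm]
  simp

theorem weight_varWt_col (N : Var n m q →₀ ℕ) (l : Fin q) :
    (Finsupp.weight varWt N).2.2 l = ∑ j, N (Sum.inr (j, l)) := by
  rw [Finsupp.weight_eq_sum]
  simp only [Fintype.sum_sum_type, Fintype.sum_prod_type, varWt, Prod.smul_mk, Prod.fst_add,
    Prod.snd_add, Prod.snd_sum,
    Prod.fst_sum, Pi.add_apply, Finset.sum_apply, Pi.smul_apply, Pi.zero_apply, Pi.single_apply,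
    smul_eq_mul, mul_ite, mul_one, mul_zero, smul_zero, Finset.sum_const_zero, zero_add]
  simp

end Order

section Tame

variable (K : Type) [Field K] (n m q : ℕ)

/-- The polynomials invariant under the shears of the columns of `U` and the rows of `W`. -/
noncomputable def shearInv : Subalgebra K (KX K n m q) where
  carrier := {f | ∀ j j' : Fin n, j ≠ j' → ∀ θ θ' : Var n m q → KX K n m q,
    (∀ i, θ' (shearVar j j' (i, false)) = θ (shearVar j j' (i, false)) -
      C (shearSign K i) * θ (shearVar j j' (i, true))) →
    (∀ s, (∀ i, s ≠ shearVar j j' (i, false)) → θ' s = θ s) → aeval θ' f = aeval θ f}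
  mul_mem' := by
    intro a b ha hb j j' h θ θ' h1 h2
    rw [map_mul, map_mul, ha j j' h θ θ' h1 h2, hb j j' h θ θ' h1 h2]
  add_mem' := by
    intro a b ha hb j j' h θ θ' h1 h2
    rw [map_add, map_add, ha j j' h θ θ' h1 h2, hb j j' h θ θ' h1 h2]
  algebraMap_mem' := by
    intro r j j' h θ θ' h1 h2
    rw [AlgHom.commutes, AlgHom.commutes]

/-- Shear invariants of given torus weight and contents. -/
noncomputable def tame (κ : ℤ) (c : (Fin m → ℕ) × (Fin q → ℕ)) : Submodule K (KX K n m q) :=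
  Subalgebra.toSubmodule (shearInv K n m q) ⊓
    weightedHomogeneousSubmodule K varWt ((fun _ => κ), c)

variable {K n m q}

theorem mem_tame {κ : ℤ} {c : (Fin m → ℕ) × (Fin q → ℕ)} {f : KX K n m q} :
    f ∈ tame K n m q κ c ↔ f ∈ shearInv K n m q ∧
      IsWeightedHomogeneous varWt f ((fun _ => κ), c) := Iff.rfl

theorem tame_mul {κ κ' : ℤ} {c c' : (Fin m → ℕ) × (Fin q → ℕ)} {f g : KX K n m q}
    (hf : f ∈ tame K n m q κ c) (hg : g ∈ tame K n m q κ' c') :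
    f * g ∈ tame K n m q (κ + κ') (c + c') := by
  rw [mem_tame] at *
  exact ⟨mul_mem hf.1 hg.1, hf.2.mul hg.2⟩

theorem tame_one : (1 : KX K n m q) ∈ tame K n m q 0 0 := by
  rw [mem_tame]
  exact ⟨one_mem _, isWeightedHomogeneous_one _ _⟩

theorem weight_eq_of_mem_tame {κ : ℤ} {c : (Fin m → ℕ) × (Fin q → ℕ)} {f : KX K n m q}
    (hf : f ∈ tame K n m q κ c) {N : Var n m q →₀ ℕ} (hN : N ∈ f.support) :
    Finsupp.weight varWt N = ((fun _ => κ), c) :=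
  (mem_tame.1 hf).2 (mem_support_iff.1 hN)

theorem torus_of_mem_tame {κ : ℤ} {c : (Fin m → ℕ) × (Fin q → ℕ)} {f : KX K n m q}
    (hf : f ∈ tame K n m q κ c) {N : Var n m q →₀ ℕ} (hN : N ∈ f.support) (j : Fin n) :
    ∑ i, (N (Sum.inl (i, j)) : ℤ) = ∑ l, (N (Sum.inr (j, l)) : ℤ) + κ := by
  have := congrArg (fun z => z.1 j) (weight_eq_of_mem_tame hf hN)
  simp only [weight_varWt_torus] at this
  linarith

theorem row_eq_of_mem_tame {κ : ℤ} {c : (Fin m → ℕ) × (Fin q → ℕ)} {f : KX K n m q}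
    (hf : f ∈ tame K n m q κ c) {N : Var n m q →₀ ℕ} (hN : N ∈ f.support) (i : Fin m) :
    ∑ j, N (Sum.inl (i, j)) = c.1 i := by
  have := congrArg (fun z => z.2.1 i) (weight_eq_of_mem_tame hf hN)
  simpa only [weight_varWt_row] using this

theorem col_eq_of_mem_tame {κ : ℤ} {c : (Fin m → ℕ) × (Fin q → ℕ)} {f : KX K n m q}
    (hf : f ∈ tame K n m q κ c) {N : Var n m q →₀ ℕ} (hN : N ∈ f.support) (l : Fin q) :
    ∑ j, N (Sum.inr (j, l)) = c.2 l := by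
  have := congrArg (fun z => z.2.2 l) (weight_eq_of_mem_tame hf hN)
  simpa only [weight_varWt_col] using this

end Tame

end SMB

namespace SMB
open MvPolynomial

section Leading

variable {K : Type} [Field K] {n m q : ℕ} {κ : ℤ} {c : (Fin m → ℕ) × (Fin q → ℕ)}
  {f : KX K n m q}

theorem shearSign_mul_self (i : Fin m ⊕ Fin q) : shearSign K i * shearSign K i = 1 := by
  cases i <;> simp [shearSign]

theorem shearVar_content_eq (hf : f ∈ tame K n m q κ c) {j j' : Fin n} (hj : j ≠ j')
    {N M : Var n m q →₀ ℕ} (hN : N ∈ f.support) (hM : M ∈ f.support)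
    (h : ∀ s, (∀ p, s ≠ shearVar j j' p) → N s = M s) (i : Fin m ⊕ Fin q) :
    N (shearVar j j' (i, false)) + N (shearVar j j' (i, true)) =
      M (shearVar j j' (i, false)) + M (shearVar j j' (i, true)) := by
  have key : ∀ g h : Fin n → ℕ, (∀ k, k ≠ j → k ≠ j' → g k = h k) → ∑ k, g k = ∑ k, h k →
      g j + g j' = h j + h j' := by
    intro g h h1 h2
    rw [← Finset.add_sum_erase _ _ (Finset.mem_univ j), ← Finset.add_sum_erase _ _
      (Finset.mem_univ j), ← Finset.add_sum_erase (Finset.univ.erase j) g (a := j')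
      (by simp [hj.symm]), ← Finset.add_sum_erase (Finset.univ.erase j) h (a := j')
      (by simp [hj.symm])] at h2
    have : ∑ x ∈ (Finset.univ.erase j).erase j', g x = ∑ x ∈ (Finset.univ.erase j).erase j', h x :=
      Finset.sum_congr rfl fun k hk => by
        simp only [Finset.mem_erase, Finset.mem_univ, and_true] at hk
        exact h1 k hk.2 hk.1
    omega
  cases i with
  | inl i =>
    refine key (fun k => N (Sum.inl (i, k))) (fun k => M (Sum.inl (i, k))) ?_ ?_
    · intro k h1 h2
      refine h _ ?_
      rintro ⟨i' | l', _ | _⟩ <;> simp [shearVar, h1, h2]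
    · rw [row_eq_of_mem_tame hf hN, row_eq_of_mem_tame hf hM]
  | inr l =>
    have := key (fun k => N (Sum.inr (k, l))) (fun k => M (Sum.inr (k, l))) ?_ ?_
    · simp only [shearVar, if_true, Bool.false_eq_true, if_false]
      omega
    · intro k h1 h2
      refine h _ ?_
      rintro ⟨i' | l', _ | _⟩ <;> simp [shearVar, h1, h2]
    · rw [col_eq_of_mem_tame hf hN, col_eq_of_mem_tame hf hM]

theorem shearVar_torus_eq (hf : f ∈ tame K n m q κ c) (j j' : Fin n)
    {N : Var n m q →₀ ℕ} (hN : N ∈ f.support) :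
    ∑ i, N (shearVar j j' (i, false)) = ∑ i, N (shearVar j j' (i, true)) := by
  have h1 := torus_of_mem_tame hf hN j
  have h2 := torus_of_mem_tame hf hN j'
  simp only [Fintype.sum_sum_type, shearVar, if_true, Bool.false_eq_true, if_false]
  zify
  linarith

theorem degree_row_shear (hf : f ∈ tame K n m q κ c) (h0 : f ≠ 0) {j j' : Fin n}
    (hj : j'.1 = j.1 + 1) (i₀ : Fin m) :
    ord.degree f (Sum.inl (i₀, j')) + ∑ i with i < i₀, ord.degree f (Sum.inl (i, j')) ≤
      ∑ i with i < i₀, ord.degree f (Sum.inl (i, j)) := by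
  classical
  have hne : j ≠ j' := fun h => by simp [h] at hj
  have hM := ord.degree_mem_support h0
  set M := ord.degree f with hMdef
  have key := pivot_le_of_shear_invariant (shearVar j j') (shearVar_injective hne) (shearSign K)
    shearSign_mul_self (fun i => ∃ i', i = Sum.inl i' ∧ i' < i₀) (Sum.inl i₀) (by simp) f M hM
    ((mem_tame.1 hf).1 j j' hne) (fun N hN h => shearVar_content_eq hf hne hN hM h)
    (fun N hN => shearVar_torus_eq hf j j' hN) ?_
  · have e : ∀ g : Fin m ⊕ Fin q → ℕ,
        ∑ i with (∃ i', i = Sum.inl i' ∧ i' < i₀), g i = ∑ i with i < i₀, g (Sum.inl i) := by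
      intro g
      rw [Finset.sum_filter, Finset.sum_filter, Fintype.sum_sum_type]
      simp
    rw [e, e] at key
    simpa [shearVar] using key
  · intro N hN hoff hlo
    rcases ord_le_cases (ord.le_degree hN) with rfl | ⟨t, ht, hlt⟩
    · exact ⟨fun _ _ => rfl, le_rfl⟩
    have htr : ∃ p, t = shearVar j j' p := by
      by_contra hcon
      push Not at hcon
      exact hlt.ne (hoff t hcon)
    obtain ⟨⟨i | l, b⟩, rfl⟩ := htr
    · cases b with
      | false =>
        have hi : ¬ i < i₀ := fun hi => hlt.not_ge (hlo _ ⟨i, rfl, hi⟩)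
        refine ⟨?_, ?_⟩
        · rintro _ ⟨i', rfl, hi'⟩
          refine ht _ ?_
          rw [rk_lt_iff]
          simp only [shearVar, rk, ofLex_toLex, Bool.false_eq_true, if_false, true_and]
          omega
        · by_cases hii : i = i₀
          · subst hii; exact hlt.le
          · refine (ht _ ?_).le
            rw [rk_lt_iff]
            simp only [shearVar, rk, ofLex_toLex, Bool.false_eq_true, if_false, true_and]
            omega
      | true =>
        have : ∀ i', N (shearVar j j' (Sum.inl i', false)) = M (shearVar j j' (Sum.inl i', false)) := by
          intro i'
          refine ht _ ?_
          rw [rk_lt_iff]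
          simp only [shearVar, rk, ofLex_toLex, Bool.false_eq_true, if_false, if_true]
          omega
        refine ⟨?_, (this _).le⟩
        rintro _ ⟨i', rfl, hi'⟩
        exact this i'
    · have : ∀ i', N (shearVar j j' (Sum.inl i', false)) = M (shearVar j j' (Sum.inl i', false)) := by
        intro i'
        refine ht _ ?_
        rw [rk_lt_iff]
        have := j.2
        have := j'.2
        cases b <;> simp only [shearVar, rk, ofLex_toLex, Bool.false_eq_true, if_false, if_true] <;>
          omega
      refine ⟨?_, (this _).le⟩
      rintro _ ⟨i', rfl, hi'⟩
      exact this i'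

theorem degree_col_shear (hf : f ∈ tame K n m q κ c) (h0 : f ≠ 0) {j j' : Fin n}
    (hj : j'.1 = j.1 + 1) (l₀ : Fin q) :
    ord.degree f (Sum.inr (j', l₀)) + ∑ l with l < l₀, ord.degree f (Sum.inr (j', l)) ≤
      ∑ l with l < l₀, ord.degree f (Sum.inr (j, l)) := by
  classical
  have hne : j ≠ j' := fun h => by simp [h] at hj
  have hM := ord.degree_mem_support h0
  have t1 := torus_of_mem_tame hf hM j
  have t2 := torus_of_mem_tame hf hM j'
  set M := ord.degree f with hMdef
  have key := pivot_le_of_shear_invariant (shearVar j j') (shearVar_injective hne) (shearSign K)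
    shearSign_mul_self (fun i => ∀ l, i = Sum.inr l → l₀ < l) (Sum.inr l₀) (by simp) f M hM
    ((mem_tame.1 hf).1 j j' hne) (fun N hN h => shearVar_content_eq hf hne hN hM h)
    (fun N hN => shearVar_torus_eq hf j j' hN) ?_
  · have e : ∀ g : Fin m ⊕ Fin q → ℕ,
        ∑ i with (∀ l, i = Sum.inr l → l₀ < l), g i =
          ∑ i, g (Sum.inl i) + ∑ l with l₀ < l, g (Sum.inr l) := by
      intro g
      rw [Finset.sum_filter, Finset.sum_filter, Fintype.sum_sum_type]
      simp
    rw [e, e] at key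
    simp only [shearVar, if_true, Bool.false_eq_true, if_false] at key
    have s : ∀ g : Fin q → ℕ, ∑ l, g l = ∑ l with l < l₀, g l + (g l₀ + ∑ l with l₀ < l, g l) := by
      intro g
      rw [← Finset.sum_filter_add_sum_filter_not Finset.univ (fun l => l < l₀)]
      congr 1
      rw [← Finset.add_sum_erase _ _ (a := l₀) (by simp)]
      congr 1
      refine Finset.sum_congr ?_ fun _ _ => rfl
      ext l
      simp only [Finset.mem_erase, Finset.mem_filter, Finset.mem_univ, true_and, not_lt]
      exact ⟨fun h => lt_of_le_of_ne h.2 h.1.symm, fun h => ⟨h.ne', h.le⟩⟩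
    have s1 := s (fun l => M (Sum.inr (j, l)))
    have s2 := s (fun l => M (Sum.inr (j', l)))
    zify at s1 s2 key ⊢
    linarith
  · intro N hN hoff hlo
    rcases ord_le_cases (ord.le_degree hN) with rfl | ⟨t, ht, hlt⟩
    · exact ⟨fun _ _ => rfl, le_rfl⟩
    have htr : ∃ p, t = shearVar j j' p := by
      by_contra hcon
      push Not at hcon
      exact hlt.ne (hoff t hcon)
    have hj1 := j.2
    have hj2 := j'.2
    obtain ⟨⟨i | l, b⟩, rfl⟩ := htr
    · cases b with
      | false => exact absurd (hlo (Sum.inl i) (by simp)) hlt.not_ge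
      | true =>
        have h1 := shearVar_content_eq hf hne hN hM hoff (Sum.inl i)
        have h2 : N (shearVar j j' (Sum.inl i, false)) = M (shearVar j j' (Sum.inl i, false)) := by
          refine ht _ ?_
          rw [rk_lt_iff]
          simp only [shearVar, rk, ofLex_toLex, Bool.false_eq_true, if_false, if_true]
          omega
        rw [← hMdef] at hlt
        omega
    · have hu : ∀ i, N (shearVar j j' (Sum.inl i, false)) = M (shearVar j j' (Sum.inl i, false)) := by
        intro i'
        refine ht _ ?_
        rw [rk_lt_iff]
        cases b <;> simp only [shearVar, rk, ofLex_toLex, Bool.false_eq_true, if_false, if_true] <;>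
          omega
      cases b with
      | false =>
        have hl : ¬ l₀ < l := fun hl => hlt.not_ge (hlo _ (by simpa using hl))
        have hx : ∀ l', l < l' → N (shearVar j j' (Sum.inr l', false)) =
            M (shearVar j j' (Sum.inr l', false)) := by
          intro l' hl'
          refine ht _ ?_
          rw [rk_lt_iff]
          simp only [shearVar, rk, ofLex_toLex, Bool.false_eq_true, if_false, true_and]
          omega
        refine ⟨?_, ?_⟩
        · rintro (i' | l') h
          · exact hu i'
          · exact hx l' (lt_of_le_of_lt (not_lt.1 hl) (h l' rfl))
        · by_cases hii : l = l₀
          · subst hii; exact hlt.le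
          · exact (hx l₀ (lt_of_le_of_ne (not_lt.1 hl) hii)).le
      | true =>
        have hx : ∀ l', N (shearVar j j' (Sum.inr l', false)) =
            M (shearVar j j' (Sum.inr l', false)) := by
          intro l'
          refine ht _ ?_
          rw [rk_lt_iff]
          simp only [shearVar, rk, ofLex_toLex, Bool.false_eq_true, if_false, if_true]
          omega
        refine ⟨?_, (hx _).le⟩
        rintro (i' | l') _
        · exact hu i'
        · exact hx l'

end Leading

end SMB

namespace SMB
open MvPolynomial

section Generators

variable (K : Type) [Field K] {n m q : ℕ}

/-- Torus weight of a generator. -/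
def kap : HElt n m q → ℤ
  | Sum.inl _ => 1
  | Sum.inr (Sum.inl _) => -1
  | Sum.inr (Sum.inr _) => 0

/-- Row and column content of a generator. -/
def cont : HElt n m q → (Fin m → ℕ) × (Fin q → ℕ)
  | Sum.inl I => (∑ k, Pi.single (I.f k) 1, 0)
  | Sum.inr (Sum.inl J) => (0, ∑ k, Pi.single (J.f k) 1)
  | Sum.inr (Sum.inr P) => (∑ k, Pi.single (P.1.rows k) 1, ∑ k, Pi.single (P.1.cols k) 1)

variable {K}

theorem isWeightedHomogeneous_det {σ M ι : Type} [AddCommMonoid M] [Fintype ι] [DecidableEq ι]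
    {w : σ → M} (A : Matrix ι ι (MvPolynomial σ K)) (a b : ι → M)
    (h : ∀ i j, IsWeightedHomogeneous w (A i j) (a i + b j)) :
    IsWeightedHomogeneous w A.det (∑ i, a i + ∑ i, b i) := by
  rw [Matrix.det_apply]
  refine IsWeightedHomogeneous.sum _ _ _ fun τ _ => ?_
  have h1 : IsWeightedHomogeneous w (∏ i, A (τ i) i) (∑ i, (a (τ i) + b i)) :=
    IsWeightedHomogeneous.prod _ _ _ fun i _ => h _ _
  rw [Finset.sum_add_distrib, Equiv.sum_comp τ a] at h1
  rcases Int.units_eq_one_or (Equiv.Perm.sign τ) with hs | hs <;> rw [hs]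
  · simpa using h1
  · rw [Units.neg_smul, one_smul]
    exact (weightedHomogeneousSubmodule K w _).neg_mem h1

/-- The matrix of values at the variables of `U`. -/
def uMat {S : Type} (θ : Var n m q → S) : Matrix (Fin m) (Fin n) S :=
  Matrix.of fun i j => θ (Sum.inl (i, j))

/-- The matrix of values at the variables of `W`. -/
def wMat {S : Type} (θ : Var n m q → S) : Matrix (Fin n) (Fin q) S :=
  Matrix.of fun j l => θ (Sum.inr (j, l))

theorem aeval_uPoly {S : Type} [CommRing S] [Algebra K S] (θ : Var n m q → S) (I : Fin n → Fin m) :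
    aeval θ (uPoly K n m q I) = ((uMat θ).submatrix I id).det := by
  rw [uPoly, AlgHom.map_det]
  congr 1
  ext i j
  simp [uMat]

theorem aeval_xiPoly {S : Type} [CommRing S] [Algebra K S] (θ : Var n m q → S) (J : Fin n → Fin q) :
    aeval θ (xiPoly K n m q J) = ((wMat θ).submatrix id J).det := by
  rw [xiPoly, AlgHom.map_det]
  congr 1
  ext i j
  simp [wMat]

theorem aeval_pPoly {S : Type} [CommRing S] [Algebra K S] (θ : Var n m q → S) (P : PairIx m q) :
    aeval θ (pPoly K n m q P) = ((uMat θ * wMat θ).submatrix P.rows P.cols).det := by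
  rw [pPoly, AlgHom.map_det]
  congr 1
  ext i j
  simp [uMat, wMat, Ugen, Wgen, Matrix.mul_apply]

theorem polyOf_mem_shearInv (x : HElt n m q) : polyOf K n m q x ∈ shearInv K n m q := by
  intro j j' hj θ θ' h1 h2
  have hU : uMat θ' = uMat θ * Matrix.transvection j' j (-1 : KX K n m q) := by
    refine Matrix.ext fun i k => ?_
    by_cases hk : k = j
    · subst hk
      rw [Matrix.mul_transvection_apply_same]
      have := h1 (Sum.inl i)
      simp only [shearVar, shearSign, Bool.false_eq_true, if_false, if_true, C_1, one_mul] at this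
      rw [uMat, Matrix.of_apply, this, uMat, Matrix.of_apply, Matrix.of_apply]
      ring
    · rw [Matrix.mul_transvection_apply_of_ne _ _ _ _ hk]
      refine h2 _ ?_
      rintro (i' | l) <;> simp [shearVar, hk]
  have hW : wMat θ' = Matrix.transvection j' j (1 : KX K n m q) * wMat θ := by
    refine Matrix.ext fun k l => ?_
    by_cases hk : k = j'
    · subst hk
      rw [Matrix.transvection_mul_apply_same]
      have := h1 (Sum.inr l)
      simp only [shearVar, shearSign, Bool.false_eq_true, if_false, if_true, C_neg, C_1] at this
      rw [wMat, Matrix.of_apply, this, wMat, Matrix.of_apply, Matrix.of_apply]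
      ring
    · rw [Matrix.transvection_mul_apply_of_ne _ _ _ _ hk]
      refine h2 _ ?_
      rintro (i' | l) <;> simp [shearVar, hk]
  rcases x with I | J | P
  · simp only [polyOf]
    rw [aeval_uPoly, aeval_uPoly, hU]
    have : (uMat θ * Matrix.transvection j' j (-1 : KX K n m q)).submatrix I.f id =
        (uMat θ).submatrix I.f id * Matrix.transvection j' j (-1 : KX K n m q) := by
      refine Matrix.ext fun a b => ?_; simp [Matrix.mul_apply]
    rw [this, Matrix.det_mul, Matrix.det_transvection_of_ne _ _ hj.symm, mul_one]
  · simp only [polyOf]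
    rw [aeval_xiPoly, aeval_xiPoly, hW]
    have : (Matrix.transvection j' j (1 : KX K n m q) * wMat θ).submatrix id J.f =
        Matrix.transvection j' j (1 : KX K n m q) * (wMat θ).submatrix id J.f := by
      refine Matrix.ext fun a b => ?_; simp [Matrix.mul_apply]
    rw [this, Matrix.det_mul, Matrix.det_transvection_of_ne _ _ hj.symm, one_mul]
  · simp only [polyOf]
    rw [aeval_pPoly, aeval_pPoly, hU, hW, Matrix.mul_assoc, ← Matrix.mul_assoc
      (Matrix.transvection j' j (-1 : KX K n m q)), Matrix.transvection_mul_transvection_same _ _ hj.symm]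
    simp

theorem isWeightedHomogeneous_polyOf (x : HElt n m q) :
    IsWeightedHomogeneous varWt (polyOf K n m q x) ((fun _ => kap x), cont x) := by
  rcases x with I | J | P
  · have := isWeightedHomogeneous_det (w := varWt)
      (Matrix.of fun i j : Fin n => (X (Sum.inl (I.f i, j)) : KX K n m q))
      (fun i => (0, Pi.single (I.f i) 1, 0)) (fun j => (Pi.single j 1, 0, 0)) (fun i j => by
        simpa [varWt] using isWeightedHomogeneous_X K (varWt : Var n m q → _) (Sum.inl (I.f i, j)))
    convert this using 1
    · rfl
    refine Prod.ext ?_ (Prod.ext ?_ ?_)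
    · funext k
      simp [kap, Prod.fst_sum, Finset.sum_apply, Pi.single_apply]
    · simp [cont, Prod.snd_sum, Prod.fst_sum]
    · simp [cont, Prod.snd_sum]
  · have := isWeightedHomogeneous_det (w := varWt)
      (Matrix.of fun i j : Fin n => (X (Sum.inr (i, J.f j)) : KX K n m q))
      (fun j => (-Pi.single j 1, 0, 0)) (fun i => (0, 0, Pi.single (J.f i) 1))  (fun i j => by
        simpa [varWt] using isWeightedHomogeneous_X K (varWt : Var n m q → _) (Sum.inr (i, J.f j)))
    convert this using 1
    · rfl
    refine Prod.ext ?_ (Prod.ext ?_ ?_)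
    · funext k
      simp [kap, Prod.fst_sum, Finset.sum_apply, Pi.single_apply]
    · simp [cont, Prod.snd_sum, Prod.fst_sum]
    · simp [cont, Prod.snd_sum]
  · have := isWeightedHomogeneous_det (w := varWt)
      (Matrix.of fun i j : Fin P.1.s =>
        (Ugen K n m q * Wgen K n m q) (P.1.rows i) (P.1.cols j))
      (fun i => (0, Pi.single (P.1.rows i) 1, 0)) (fun j => (0, 0, Pi.single (P.1.cols j) 1))
      (fun i j => by
        rw [Matrix.of_apply, Matrix.mul_apply]
        refine IsWeightedHomogeneous.sum _ _ _ fun k _ => ?_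
        have h1 := isWeightedHomogeneous_X K (varWt : Var n m q → _) (Sum.inl (P.1.rows i, k))
        have h2 := isWeightedHomogeneous_X K (varWt : Var n m q → _) (Sum.inr (k, P.1.cols j))
        simpa [varWt, Ugen, Wgen] using h1.mul h2)
    convert this using 1
    · rfl
    refine Prod.ext ?_ (Prod.ext ?_ ?_)
    · funext k
      simp [kap, Prod.fst_sum]
    · simp [cont, Prod.snd_sum, Prod.fst_sum]
    · simp [cont, Prod.snd_sum]

theorem polyOf_mem_tame (x : HElt n m q) :
    polyOf K n m q x ∈ tame K n m q (kap x) (cont x) :=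
  mem_tame.2 ⟨polyOf_mem_shearInv x, isWeightedHomogeneous_polyOf x⟩

end Generators

end SMB

namespace SMB

section OneSided

variable {N n : ℕ}

/-- Column-strictness of a table of multiplicities. -/
def SS (E : Fin N → Fin n → ℕ) : Prop :=
  ∀ j j' : Fin n, j'.1 = j.1 + 1 → ∀ v, E v j' + ∑ i with i < v, E i j' ≤ ∑ i with i < v, E i j

/-- A tuple shifted by one and padded by `N + 1`. -/
def tupv (n : ℕ) {s : ℕ} (f : Fin s → Fin N) (j : Fin n) : ℕ :=
  if h : j.1 < s then (f ⟨j.1, h⟩).1 + 1 else N + 1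

/-- The table with a single entry in the columns where `w` takes the value of a row. -/
def ind (N : ℕ) (w : Fin n → ℕ) (i : Fin N) (j : Fin n) : ℕ := if w j = i.1 + 1 then 1 else 0

theorem tupv_of_lt {s : ℕ} (f : Fin s → Fin N) (j : Fin n) (h : j.1 < s) :
    tupv n f j = (f ⟨j.1, h⟩).1 + 1 := dif_pos h

theorem tupv_of_ge {s : ℕ} (f : Fin s → Fin N) (j : Fin n) (h : ¬ j.1 < s) :
    tupv n f j = N + 1 := dif_neg h

theorem tupv_le {s : ℕ} (f : Fin s → Fin N) (j : Fin n) : tupv n f j ≤ N + 1 := by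
  unfold tupv; split_ifs <;> omega

theorem one_le_tupv {s : ℕ} (f : Fin s → Fin N) (j : Fin n) : 1 ≤ tupv n f j := by
  unfold tupv; split_ifs <;> omega

theorem geTup_iff_tupv {s s' : ℕ} (hs : s ≤ n) (f : Fin s → Fin N) (g : Fin s' → Fin N) :
    geTup f g ↔ ∀ j, tupv n g j ≤ tupv n f j := by
  constructor
  · rintro ⟨h, hfg⟩ j
    by_cases hj : j.1 < s
    · rw [tupv_of_lt f j hj, tupv_of_lt g j (hj.trans_le h)]
      exact Nat.succ_le_succ (Fin.le_def.1 (hfg ⟨j.1, hj⟩))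
    · rw [tupv_of_ge f j hj]
      exact tupv_le g j
  · intro h
    have hss : s ≤ s' := by
      by_contra hlt
      have := h ⟨s', by omega⟩
      rw [tupv_of_ge g _ (by simp), tupv_of_lt f _ (by simpa using hlt)] at this
      omega
    refine ⟨hss, fun j => ?_⟩
    have := h ⟨j.1, j.2.trans_le hs⟩
    rw [tupv_of_lt (n := n) f ⟨j.1, j.2.trans_le hs⟩ j.2,
      tupv_of_lt (n := n) g ⟨j.1, j.2.trans_le hs⟩ (j.2.trans_le hss)] at this
    exact Fin.le_def.2 (Nat.le_of_succ_le_succ this)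

theorem sum_ind_tupv {s : ℕ} (f : Fin s → Fin N) (j : Fin n) :
    ∑ i, ind N (tupv n f) i j = if j.1 < s then 1 else 0 := by
  unfold ind
  split_ifs with h
  · rw [tupv_of_lt f j h, Finset.sum_eq_single (f ⟨j.1, h⟩)]
    · simp
    · intro b _ hb
      rw [if_neg]
      intro h'
      exact hb (Fin.ext (by omega))
    · simp
  · refine Finset.sum_eq_zero fun i _ => ?_
    rw [tupv_of_ge f j h, if_neg]
    omega

theorem strictMono_of_consecutive {s : ℕ} {α : Type} [Preorder α] (f : Fin s → α)
    (h : ∀ j j' : Fin s, j'.1 = j.1 + 1 → f j < f j') : StrictMono f := by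
  cases s with
  | zero => intro a; exact a.elim0
  | succ k => exact Fin.strictMono_iff_lt_succ.2 fun i => h _ _ (by simp)

theorem SS.sum_le {E : Fin N → Fin n → ℕ} (hE : SS E) (j j' : Fin n) (hj : j'.1 = j.1 + 1) :
    ∑ i, E i j' ≤ ∑ i, E i j := by
  cases N with
  | zero => simp
  | succ k =>
    have h := hE j j' hj (Fin.last k)
    rw [← Finset.add_sum_erase _ _ (Finset.mem_univ (Fin.last k))]
    have e : ({i | i < Fin.last k} : Finset (Fin (k + 1))) = Finset.univ.erase (Fin.last k) := by
      ext i
      simp [Fin.lt_last_iff_ne_last]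
    rw [e] at h
    exact h.trans (Finset.sum_le_sum_of_subset (Finset.erase_subset _ _))

theorem exists_initial_segment (c : Fin n → ℕ)
    (hc : ∀ j j' : Fin n, j'.1 = j.1 + 1 → c j' ≤ c j) : ∃ r ≤ n, ∀ j : Fin n, j.1 < r ↔ 0 < c j := by
  have hanti : Antitone c := by
    cases n with
    | zero => intro a; exact a.elim0
    | succ k => exact Fin.antitone_iff_succ_le.2 fun i => hc _ _ (by simp)
  classical
  have hex : ∃ k, ∀ h : k < n, c ⟨k, h⟩ = 0 := ⟨n, fun h => absurd h (lt_irrefl _)⟩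
  refine ⟨Nat.find hex, Nat.find_min' hex (fun h => absurd h (lt_irrefl _)), fun j => ⟨fun h => ?_, fun h => ?_⟩⟩
  · have := Nat.find_min hex h
    push Not at this
    obtain ⟨_, h2⟩ := this
    exact Nat.pos_of_ne_zero h2
  · by_contra hlt
    push Not at hlt
    have h1 := Nat.find_spec hex (hlt.trans_lt j.2)
    have h2 := hanti (show (⟨_, hlt.trans_lt j.2⟩ : Fin n) ≤ j from hlt)
    omega

theorem SS.exists_min {E : Fin N → Fin n → ℕ} (hE : SS E) (r : ℕ) (hr : r ≤ n)
    (hc : ∀ j : Fin n, j.1 < r ↔ 0 < ∑ i, E i j) :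
    ∃ f : Fin r → Fin N, StrictMono f ∧ (∀ i j, 0 < E i j → tupv n f j ≤ i.1 + 1) ∧
      (∀ i j, ind N (tupv n f) i j ≤ E i j) ∧ SS (fun i j => E i j - ind N (tupv n f) i j) := by
  classical
  have hex : ∀ j : Fin r, ∃ i, 0 < E i ⟨j.1, j.2.trans_le hr⟩ := by
    intro j
    by_contra hcon
    push Not at hcon
    have := (hc ⟨j.1, j.2.trans_le hr⟩).1 j.2
    rw [Finset.sum_eq_zero fun i _ => Nat.le_zero.1 (hcon i)] at this
    exact lt_irrefl _ this
  have hmin : ∀ j : Fin r, ∃ i, 0 < E i ⟨j.1, j.2.trans_le hr⟩ ∧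
      ∀ i', 0 < E i' ⟨j.1, j.2.trans_le hr⟩ → i ≤ i' := by
    intro j
    obtain ⟨i, hi, hi'⟩ := WellFounded.has_min (wellFounded_lt (α := Fin N))
      {i | 0 < E i ⟨j.1, j.2.trans_le hr⟩} (hex j)
    exact ⟨i, hi, fun i' h => not_lt.1 (hi' i' h)⟩
  choose f hf1 hf2 using hmin
  have hle : ∀ i j, 0 < E i j → tupv n f j ≤ i.1 + 1 := by
    intro i j hij
    have hj : j.1 < r := by
      rw [hc]
      exact hij.trans_le (Finset.single_le_sum (f := fun i => E i j) (fun _ _ => Nat.zero_le _)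
        (Finset.mem_univ i))
    rw [tupv_of_lt f j hj]
    exact Nat.succ_le_succ (hf2 ⟨j.1, hj⟩ i hij)
  have hind : ∀ i j, ind N (tupv n f) i j ≤ E i j := by
    intro i j
    unfold ind
    split_ifs with h
    · by_cases hj : j.1 < r
      · rw [tupv_of_lt f j hj] at h
        have : f ⟨j.1, hj⟩ = i := Fin.ext (by omega)
        rw [← this]
        exact hf1 ⟨j.1, hj⟩
      · rw [tupv_of_ge f j hj] at h
        omega
    · exact Nat.zero_le _
  refine ⟨f, ?_, hle, hind, ?_⟩
  · refine strictMono_of_consecutive f fun j j' hj => ?_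
    have h1 := hE ⟨j.1, j.2.trans_le hr⟩ ⟨j'.1, j'.2.trans_le hr⟩ hj (f j')
    have h2 := hf1 j'
    have h3 : ∑ i with i < f j', E i ⟨j.1, j.2.trans_le hr⟩ ≠ 0 := by omega
    obtain ⟨i, hi, hi'⟩ := Finset.exists_ne_zero_of_sum_ne_zero h3
    exact (hf2 j i (Nat.pos_of_ne_zero hi')).trans_lt (by simpa using hi)
  · intro j j' hj v
    beta_reduce
    have hs : ∀ (A : Finset (Fin N)) (k : Fin n), ∑ i ∈ A, (E i k - ind N (tupv n f) i k) +
        ∑ i ∈ A, ind N (tupv n f) i k = ∑ i ∈ A, E i k := by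
      intro A k
      rw [← Finset.sum_add_distrib]
      exact Finset.sum_congr rfl fun i _ => Nat.sub_add_cancel (hind i k)
    have h1 := hE j j' hj v
    have hA : ∀ g : Fin N → ℕ, g v + ∑ i with i < v, g i = ∑ i with i ≤ v, g i := by
      intro g
      rw [← Finset.add_sum_erase ({i | i ≤ v} : Finset (Fin N)) g (a := v) (by simp)]
      congr 1
      refine Finset.sum_congr ?_ fun _ _ => rfl
      ext i
      simp only [Finset.mem_filter, Finset.mem_univ, true_and, Finset.mem_erase]
      exact ⟨fun h => ⟨h.ne, h.le⟩, fun h => lt_of_le_of_ne h.2 h.1⟩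
    have e1 := hs {i | i ≤ v} j'
    have e2 := hs {i | i < v} j
    have hB := hA (fun i => E i j')
    have hC := hA (fun i => E i j' - ind N (tupv n f) i j')
    beta_reduce at hB hC
    have hle1 : ∑ i with i < v, ind N (tupv n f) i j ≤ 1 := by
      refine (Finset.sum_le_sum_of_subset (Finset.subset_univ _)).trans ?_
      rw [sum_ind_tupv]
      split_ifs <;> simp
    by_cases h0 : ∑ i with i ≤ v, E i j' = 0
    · omega
    · obtain ⟨i, hi, hi'⟩ := Finset.exists_ne_zero_of_sum_ne_zero h0
      simp only [Finset.mem_filter, Finset.mem_univ, true_and] at hi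
      have hj' : j'.1 < r := by
        rw [hc]
        exact (Nat.pos_of_ne_zero hi').trans_le (Finset.single_le_sum (f := fun i => E i j')
          (fun _ _ => Nat.zero_le _) (Finset.mem_univ i))
      have h4 : 1 ≤ ∑ i with i ≤ v, ind N (tupv n f) i j' := by
        refine le_trans ?_ (Finset.single_le_sum (f := fun i => ind N (tupv n f) i j')
          (fun _ _ => Nat.zero_le _) (a := f ⟨j'.1, hj'⟩) ?_)
        · simp [ind, tupv_of_lt f j' hj']
        · simp only [Finset.mem_filter, Finset.mem_univ, true_and]
          exact (hf2 ⟨j'.1, hj'⟩ i (Nat.pos_of_ne_zero hi')).trans hi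
      omega

end OneSided

end SMB

namespace SMB

section Lead

variable {n m q : ℕ}

theorem eq_of_tupv_eq {N s s' : ℕ} {f : Fin s → Fin N} {g : Fin s' → Fin N} (hs : s ≤ n)
    (hs' : s' ≤ n) (h : tupv n f = tupv n g) :
    s = s' ∧ ∀ j (h1 : j < s) (h2 : j < s'), f ⟨j, h1⟩ = g ⟨j, h2⟩ := by
  obtain ⟨h1, -⟩ := (geTup_iff_tupv hs f g).2 fun j => (congrFun h j).ge
  obtain ⟨h2, -⟩ := (geTup_iff_tupv hs' g f).2 fun j => (congrFun h j).le
  refine ⟨le_antisymm h1 h2, fun j hj hj' => Fin.ext ?_⟩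
  have := congrFun h ⟨j, hj.trans_le hs⟩
  rw [tupv_of_lt f ⟨j, hj.trans_le hs⟩ hj, tupv_of_lt g ⟨j, hj.trans_le hs⟩ hj'] at this
  exact Nat.succ.inj this

/-- Padded row indices of a generator. -/
def rowv : HElt n m q → Fin n → ℕ
  | Sum.inl I => tupv n I.f
  | Sum.inr (Sum.inl _) => 0
  | Sum.inr (Sum.inr P) => tupv n P.1.rows

/-- Padded column indices of a generator. -/
def colv : HElt n m q → Fin n → ℕ
  | Sum.inl _ => 0
  | Sum.inr (Sum.inl J) => tupv n J.f
  | Sum.inr (Sum.inr P) => tupv n P.1.cols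

theorem rowv_le (x : HElt n m q) (j : Fin n) : rowv x j ≤ m + 1 := by
  rcases x with I | J | P
  · exact tupv_le _ _
  · exact Nat.zero_le _
  · exact tupv_le _ _

theorem colv_le (x : HElt n m q) (j : Fin n) : colv x j ≤ q + 1 := by
  rcases x with I | J | P
  · exact Nat.zero_le _
  · exact tupv_le _ _
  · exact tupv_le _ _

theorem tupv_le_tupv_iff {N s : ℕ} (hs : s ≤ n) (f g : Fin s → Fin N) :
    tupv n f ≤ tupv n g ↔ ∀ j, f j ≤ g j := by
  rw [Pi.le_def, ← geTup_iff_tupv hs g f]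
  exact ⟨fun ⟨_, h⟩ => h, fun h => ⟨le_rfl, h⟩⟩

theorem not_tupv_le_zero (hn : 0 < n) {N s : ℕ} (f : Fin s → Fin N) : ¬ tupv n f ≤ 0 := by
  intro h
  have h1 := h ⟨0, hn⟩
  have h2 := one_le_tupv (n := n) f ⟨0, hn⟩
  simp only [Pi.zero_apply] at h1
  omega

theorem hle_iff (hn : 0 < n) (x y : HElt n m q) :
    hle x y ↔ rowv x ≤ rowv y ∧ colv x ≤ colv y := by
  rcases x with I | J | P <;> rcases y with I' | J' | P'
  · simp [hle, rowv, colv, tupv_le_tupv_iff le_rfl]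
  · simp [hle, rowv, colv, not_tupv_le_zero hn]
  · simp only [hle, rowv, colv, geTup_iff_tupv P'.2.2]
    exact ⟨fun h => ⟨h, fun j => Nat.zero_le _⟩, fun h => h.1⟩
  · simp [hle, rowv, colv, not_tupv_le_zero hn]
  · simp [hle, rowv, colv, tupv_le_tupv_iff le_rfl]
  · simp only [hle, rowv, colv, geTup_iff_tupv P'.2.2]
    exact ⟨fun h => ⟨fun j => Nat.zero_le _, h⟩, fun h => h.2⟩
  · simp [hle, rowv, colv, not_tupv_le_zero hn]
  · simp [hle, rowv, colv, not_tupv_le_zero hn]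
  · simp only [hle, rowv, colv, PairIx.ge, geTup_iff_tupv P'.2.2, Pi.le_def]

theorem eq_of_rowv_colv (hn : 0 < n) {x y : HElt n m q} (h1 : rowv x = rowv y)
    (h2 : colv x = colv y) : x = y := by
  have key : ∀ {s N : ℕ} (f : Fin s → Fin N), tupv n f ≠ 0 := fun f h =>
    not_tupv_le_zero hn f h.le
  have inc : ∀ {N : ℕ} (I I' : IncTup n N), tupv n I.f = tupv n I'.f → I = I' := by
    rintro N ⟨f, hf⟩ ⟨g, hg⟩ h
    have := (eq_of_tupv_eq le_rfl le_rfl h).2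
    congr 1
    funext j
    exact this j.1 j.2 j.2
  rcases x with I | J | ⟨P, hP⟩ <;> rcases y with I' | J' | ⟨P', hP'⟩
  · rw [inc I I' h1]
  · exact absurd h1 (key _)
  · exact absurd h2.symm (key _)
  · exact absurd h2 (key _)
  · rw [inc J J' h2]
  · exact absurd h1.symm (key _)
  · exact absurd h2 (key _)
  · exact absurd h1 (key _)
  · congr 2
    obtain ⟨s, r, c, hr, hc⟩ := P
    obtain ⟨s', r', c', hr', hc'⟩ := P'
    obtain ⟨hs, h3⟩ := eq_of_tupv_eq hP.2 hP'.2 h1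
    obtain ⟨-, h4⟩ := eq_of_tupv_eq hP.2 hP'.2 h2
    simp only at hs
    subst hs
    have e1 : r = r' := funext fun j => h3 j.1 j.2 j.2
    have e2 : c = c' := funext fun j => h4 j.1 j.2 j.2
    subst e1
    subst e2
    rfl

theorem hle_refl (hn : 0 < n) (x : HElt n m q) : hle x x := (hle_iff hn x x).2 ⟨le_rfl, le_rfl⟩

theorem hle_antisymm (hn : 0 < n) {x y : HElt n m q} (h : hle x y) (h' : hle y x) : x = y := by
  rw [hle_iff hn] at h h'
  exact eq_of_rowv_colv hn (le_antisymm h.1 h'.1) (le_antisymm h.2 h'.2)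

/-- The sum of the padded indices of a generator. -/
def rho (x : HElt n m q) : ℕ := ∑ j, (rowv x j + colv x j)

theorem rho_le (x : HElt n m q) : rho x ≤ n * (m + q + 2) := by
  unfold rho
  refine (Finset.sum_le_sum (g := fun _ => m + q + 2) fun j _ => ?_).trans (by simp)
  have := rowv_le x j
  have := colv_le x j
  omega

theorem eq_of_hle_of_rho_le (hn : 0 < n) {x y : HElt n m q} (h : hle x y) (h' : rho y ≤ rho x) :
    x = y := by
  rw [hle_iff hn] at h
  have hle1 : ∀ j ∈ Finset.univ, rowv x j + colv x j ≤ rowv y j + colv y j :=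
    fun j _ => Nat.add_le_add (h.1 j) (h.2 j)
  have := (Finset.sum_eq_sum_iff_of_le hle1).1 (le_antisymm (Finset.sum_le_sum hle1) h')
  refine eq_of_rowv_colv hn (funext fun j => ?_) (funext fun j => ?_) <;>
  · have h1 : rowv x j + colv x j = rowv y j + colv y j := this j (Finset.mem_univ j)
    have h2 : rowv x j ≤ rowv y j := h.1 j
    have h3 : colv x j ≤ colv y j := h.2 j
    omega

theorem kap_of_hle {x y : HElt n m q} (h : hle x y) :
    (0 ≤ kap x → 0 ≤ kap y) ∧ (kap x ≤ 0 → kap y ≤ 0) := by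
  rcases x with I | J | P <;> rcases y with I' | J' | P' <;> simp_all [hle, kap]

theorem sum_ind_sub (x : HElt n m q) (j : Fin n) :
    (∑ i, ind m (rowv x) i j : ℤ) - ∑ l, (ind q (colv x) l j : ℤ) = kap x := by
  have h0 : ∀ N, ∑ i, ind N (0 : Fin n → ℕ) i j = 0 := fun N => by simp [ind]
  rw [← Nat.cast_sum, ← Nat.cast_sum]
  rcases x with I | J | P <;> simp only [rowv, colv, sum_ind_tupv, h0, kap] <;> simp

/-- Exponent of the leading monomial of a generator. -/
noncomputable def lead (x : HElt n m q) : Var n m q →₀ ℕ :=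
  Finsupp.equivFunOnFinite.symm
    (Sum.elim (fun p => ind m (rowv x) p.1 p.2) (fun p => ind q (colv x) p.2 p.1))

theorem lead_inl (x : HElt n m q) (i : Fin m) (j : Fin n) :
    lead x (Sum.inl (i, j)) = ind m (rowv x) i j := rfl

theorem lead_inr (x : HElt n m q) (j : Fin n) (l : Fin q) :
    lead x (Sum.inr (j, l)) = ind q (colv x) l j := rfl

theorem rowv_cases (x : HElt n m q) (j : Fin n) :
    (kap x < 0 ∧ rowv x j = 0) ∨ rowv x j = m + 1 ∨
      ∃ i : Fin m, rowv x j = i.1 + 1 ∧ lead x (Sum.inl (i, j)) = 1 := by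
  have h := rowv_le x j
  rcases Nat.eq_zero_or_pos (rowv x j) with h0 | h0
  · left
    rcases x with I | J | P
    · exact absurd h0 (Nat.ne_of_gt (one_le_tupv (n := n) I.f j))
    · exact ⟨by simp [kap], rfl⟩
    · exact absurd h0 (Nat.ne_of_gt (one_le_tupv (n := n) P.1.rows j))
  · right
    by_cases h1 : rowv x j = m + 1
    · exact Or.inl h1
    · refine Or.inr ⟨⟨rowv x j - 1, by omega⟩, by simp; omega, ?_⟩
      rw [lead_inl, ind, if_pos]
      simp; omega

theorem colv_cases (x : HElt n m q) (j : Fin n) :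
    (0 < kap x ∧ colv x j = 0) ∨ colv x j = q + 1 ∨
      ∃ l : Fin q, colv x j = l.1 + 1 ∧ lead x (Sum.inr (j, l)) = 1 := by
  have h := colv_le x j
  rcases Nat.eq_zero_or_pos (colv x j) with h0 | h0
  · left
    rcases x with I | J | P
    · exact ⟨by simp [kap], rfl⟩
    · exact absurd h0 (Nat.ne_of_gt (one_le_tupv (n := n) J.f j))
    · exact absurd h0 (Nat.ne_of_gt (one_le_tupv (n := n) P.1.cols j))
  · right
    by_cases h1 : colv x j = q + 1
    · exact Or.inl h1
    · refine Or.inr ⟨⟨colv x j - 1, by omega⟩, by simp; omega, ?_⟩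
      rw [lead_inr, ind, if_pos]
      simp; omega

theorem lead_ne_zero (hn : 0 < n) (x : HElt n m q) : lead x ≠ 0 := by
  intro h
  have key : ∀ {N s : ℕ} (f : Fin s → Fin N), 0 < s →
      (∀ i, ind N (tupv n f) i ⟨0, hn⟩ = 0) → False := by
    intro N s f hs hf
    have := sum_ind_tupv f ⟨0, hn⟩
    rw [Finset.sum_eq_zero fun i _ => hf i] at this
    simp [hs] at this
  rcases x with I | J | P
  · exact key I.f hn fun i => (lead_inl _ i ⟨0, hn⟩).symm.trans (DFunLike.congr_fun h _)
  · exact key J.f hn fun i => (lead_inr _ ⟨0, hn⟩ i).symm.trans (DFunLike.congr_fun h _)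
  · exact key P.1.rows P.2.1 fun i => (lead_inl _ i ⟨0, hn⟩).symm.trans (DFunLike.congr_fun h _)

end Lead

end SMB

namespace SMB

section Standard

variable {n m q : ℕ}

/-- Exponents satisfying the constraints on leading exponents of shear invariants. -/
def Good (κ : ℤ) (M : Var n m q →₀ ℕ) : Prop :=
  SS (fun i j => M (Sum.inl (i, j))) ∧ SS (fun l j => M (Sum.inr (j, l))) ∧
    ∀ j, ∑ i, (M (Sum.inl (i, j)) : ℤ) = ∑ l, (M (Sum.inr (j, l)) : ℤ) + κ

/-- Exponents of standard monomials: the support is a chain. -/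
def Std (a : HElt n m q →₀ ℕ) : Prop := ∀ x ∈ a.support, ∀ y ∈ a.support, hle x y ∨ hle y x

/-- The expected leading exponent of a monomial in the generators. -/
noncomputable def leadSum : (HElt n m q →₀ ℕ) →+ (Var n m q →₀ ℕ) := Finsupp.weight lead

theorem leadSum_single (x : HElt n m q) (k : ℕ) : leadSum (Finsupp.single x k) = k • lead x := by
  simp [leadSum, Finsupp.weight_single]

theorem lead_le_leadSum {a : HElt n m q →₀ ℕ} {x : HElt n m q} (hx : x ∈ a.support) :
    lead x ≤ leadSum a := by
  classical
  have h : Finsupp.single x 1 ≤ a := by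
    rw [Finsupp.single_le_iff]
    exact Nat.one_le_iff_ne_zero.2 (Finsupp.mem_support_iff.1 hx)
  rw [← add_tsub_cancel_of_le h, map_add, leadSum_single, one_smul]
  exact le_self_add

theorem exists_of_leadSum_ne_zero {a : HElt n m q →₀ ℕ} {t : Var n m q} (h : leadSum a t ≠ 0) :
    ∃ x ∈ a.support, lead x t ≠ 0 := by
  rw [leadSum, Finsupp.weight_apply, Finsupp.sum, Finsupp.finsetSum_apply] at h
  obtain ⟨x, hx, hx'⟩ := Finset.exists_ne_zero_of_sum_ne_zero h
  refine ⟨x, hx, fun h0 => hx' ?_⟩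
  simp [h0]

theorem sum_tsub_lead_inl {M : Var n m q →₀ ℕ} {x : HElt n m q} (h : lead x ≤ M) (j : Fin n) :
    ∑ i, ((M - lead x) (Sum.inl (i, j)) : ℤ) =
      ∑ i, (M (Sum.inl (i, j)) : ℤ) - ∑ i, (ind m (rowv x) i j : ℤ) := by
  rw [← Finset.sum_sub_distrib]
  refine Finset.sum_congr rfl fun i _ => ?_
  rw [Finsupp.tsub_apply, Nat.cast_sub (h _), lead_inl]

theorem sum_tsub_lead_inr {M : Var n m q →₀ ℕ} {x : HElt n m q} (h : lead x ≤ M) (j : Fin n) :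
    ∑ l, ((M - lead x) (Sum.inr (j, l)) : ℤ) =
      ∑ l, (M (Sum.inr (j, l)) : ℤ) - ∑ l, (ind q (colv x) l j : ℤ) := by
  rw [← Finset.sum_sub_distrib]
  refine Finset.sum_congr rfl fun i _ => ?_
  rw [Finsupp.tsub_apply, Nat.cast_sub (h _), lead_inr]

theorem ind_zero (N : ℕ) (i : Fin N) (j : Fin n) : ind N (0 : Fin n → ℕ) i j = 0 := by simp [ind]

theorem exists_min_gen {κ : ℤ} {M : Var n m q →₀ ℕ} (hM : Good κ M) (h0 : M ≠ 0) :
    ∃ x : HElt n m q, lead x ≤ M ∧ Good (κ - kap x) (M - lead x) ∧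
      (∀ i j, 0 < M (Sum.inl (i, j)) → rowv x j ≤ i.1 + 1) ∧
      (∀ l j, 0 < M (Sum.inr (j, l)) → colv x j ≤ l.1 + 1) ∧
      ((0 < κ ∧ kap x = 1 ∧ ∀ j, colv x j = 0) ∨ (κ < 0 ∧ kap x = -1 ∧ ∀ j, rowv x j = 0) ∨
        (κ = 0 ∧ kap x = 0)) := by
  obtain ⟨h1, h2, h3⟩ := hM
  have fin : ∀ x : HElt n m q, lead x ≤ M →
      SS (fun i j => (M - lead x) (Sum.inl (i, j))) →
      SS (fun l j => (M - lead x) (Sum.inr (j, l))) → Good (κ - kap x) (M - lead x) := by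
    intro x hx e1 e2
    refine ⟨e1, e2, fun j => ?_⟩
    rw [sum_tsub_lead_inl hx, sum_tsub_lead_inr hx, ← sum_ind_sub x j]
    linarith [h3 j]
  have cle : ∀ (x : HElt n m q), (∀ i j, ind m (rowv x) i j ≤ M (Sum.inl (i, j))) →
      (∀ l j, ind q (colv x) l j ≤ M (Sum.inr (j, l))) → lead x ≤ M := by
    rintro x e1 e2 (⟨i, j⟩ | ⟨j, l⟩)
    · exact e1 i j
    · exact e2 l j
  rcases lt_trichotomy κ 0 with hκ | hκ | hκ
  · obtain ⟨f, f1, f2, f3, f4⟩ := h2.exists_min n le_rfl fun j => ⟨fun _ => by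
      have := h3 j
      have h5 : (0 : ℤ) ≤ ∑ i, (M (Sum.inl (i, j)) : ℤ) :=
        Finset.sum_nonneg fun i _ => Int.natCast_nonneg _
      zify
      linarith, fun _ => j.2⟩
    have hx : lead (Sum.inr (Sum.inl ⟨f, f1⟩) : HElt n m q) ≤ M :=
      cle _ (fun i j => by simp [rowv, ind_zero]) f3
    refine ⟨Sum.inr (Sum.inl ⟨f, f1⟩), hx, fin _ hx ?_ f4, fun i j _ => ?_, f2,
      Or.inr (Or.inl ⟨hκ, rfl, fun j => rfl⟩)⟩
    · simpa [lead_inl, rowv, ind_zero] using h1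
    · simp [rowv]
  · obtain ⟨r, hr, hr'⟩ := exists_initial_segment _ h1.sum_le
    have hs : ∀ j, ∑ i, M (Sum.inl (i, j)) = ∑ l, M (Sum.inr (j, l)) := by
      intro j
      have := h3 j
      rw [hκ, add_zero] at this
      exact_mod_cast this
    obtain ⟨f, f1, f2, f3, f4⟩ := h1.exists_min r hr hr'
    obtain ⟨g, g1, g2, g3, g4⟩ := h2.exists_min r hr fun j => by rw [hr' j, hs]
    have hr0 : 0 < r := by
      by_contra hr0
      have hr0 : r = 0 := by omega
      subst hr0
      apply h0
      ext t
      rcases t with ⟨i, j⟩ | ⟨j, l⟩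
      · have : ∑ i, M (Sum.inl (i, j)) = 0 := by simpa using (hr' j).not.1 (by simp)
        exact Finset.sum_eq_zero_iff.1 this i (Finset.mem_univ i)
      · have : ∑ i, M (Sum.inl (i, j)) = 0 := by simpa using (hr' j).not.1 (by simp)
        rw [hs] at this
        exact Finset.sum_eq_zero_iff.1 this l (Finset.mem_univ l)
    have hx : lead (Sum.inr (Sum.inr ⟨⟨r, f, g, f1, g1⟩, hr0, hr⟩) : HElt n m q) ≤ M := cle _ f3 g3
    exact ⟨Sum.inr (Sum.inr ⟨⟨r, f, g, f1, g1⟩, hr0, hr⟩), hx, fin _ hx f4 g4, f2, g2,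
      Or.inr (Or.inr ⟨hκ, rfl⟩)⟩
  · obtain ⟨f, f1, f2, f3, f4⟩ := h1.exists_min n le_rfl fun j => ⟨fun _ => by
      have := h3 j
      have h5 : (0 : ℤ) ≤ ∑ l, (M (Sum.inr (j, l)) : ℤ) :=
        Finset.sum_nonneg fun i _ => Int.natCast_nonneg _
      zify
      linarith, fun _ => j.2⟩
    have hx : lead (Sum.inl ⟨f, f1⟩ : HElt n m q) ≤ M :=
      cle _ f3 (fun i j => by simp [colv, ind_zero])
    refine ⟨Sum.inl ⟨f, f1⟩, hx, fin _ hx f4 ?_, f2, fun i j _ => ?_,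
      Or.inl ⟨hκ, rfl, fun j => rfl⟩⟩
    · simpa [lead_inr, colv, ind_zero] using h2
    · simp [colv]

/-- Every exponent satisfying the constraints is the expected leading exponent of a standard
monomial. -/
theorem exists_std_of_good (hn : 0 < n) {κ : ℤ} {M : Var n m q →₀ ℕ} (hM : Good κ M) :
    ∃ a : HElt n m q →₀ ℕ, Std a ∧ leadSum a = M ∧
      (0 ≤ κ → ∀ x ∈ a.support, 0 ≤ kap x) ∧ (κ ≤ 0 → ∀ x ∈ a.support, kap x ≤ 0) := by
  classical
  induction hd : M.degree using Nat.strong_induction_on generalizing M κ with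
  | _ d ih =>
    by_cases h0 : M = 0
    · exact ⟨0, by simp [Std], by simp [h0], by simp, by simp⟩
    obtain ⟨x, hx, hg, hr, hc, ht⟩ := exists_min_gen hM h0
    have hadd : M - lead x + lead x = M := tsub_add_cancel_of_le hx
    obtain ⟨a, ha1, ha2, ha3, ha4⟩ := ih _ (by
      have h1 : M.degree = (M - lead x).degree + (lead x).degree := by rw [← map_add, hadd]
      have h2 : (lead x).degree ≠ 0 := by
        rw [Ne, Finsupp.degree_eq_zero_iff]
        exact lead_ne_zero hn x
      omega) hg rfl
    have hmin : ∀ y ∈ a.support, hle x y := by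
      intro y hy
      have hyM : lead y ≤ M := (lead_le_leadSum hy).trans (ha2.le.trans tsub_le_self)
      rw [hle_iff hn]
      constructor
      · intro j
        rcases rowv_cases y j with ⟨h1, -⟩ | h1 | ⟨i, h1, h2⟩
        · rcases ht with ⟨h2, h3, -⟩ | ⟨-, -, h2⟩ | ⟨h2, h3⟩
          · have := ha3 (by omega) y hy
            omega
          · simp [h2]
          · have := ha3 (by omega) y hy
            omega
        · rw [h1]
          exact rowv_le x j
        · rw [h1]
          exact hr i j (by have := hyM (Sum.inl (i, j)); omega)
      · intro j
        rcases colv_cases y j with ⟨h1, -⟩ | h1 | ⟨i, h1, h2⟩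
        · rcases ht with ⟨-, -, h2⟩ | ⟨h2, h3, -⟩ | ⟨h2, h3⟩
          · simp [h2]
          · have := ha4 (by omega) y hy
            omega
          · have := ha4 (by omega) y hy
            omega
        · rw [h1]
          exact colv_le x j
        · rw [h1]
          exact hc i j (by have := hyM (Sum.inr (j, i)); omega)
    have hsup : ∀ y ∈ (a + Finsupp.single x 1).support, y = x ∨ y ∈ a.support := by
      intro y hy
      rcases Finset.mem_union.1 (Finsupp.support_add hy) with h | h
      · exact Or.inr h
      · exact Or.inl (by simpa using Finsupp.support_single_subset h)
    refine ⟨a + Finsupp.single x 1, ?_, ?_, ?_, ?_⟩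
    · intro y hy z hz
      rcases hsup y hy with h | h <;> rcases hsup z hz with h' | h'
      · rw [h, h']
        exact Or.inl (hle_refl hn _)
      · rw [h]
        exact Or.inl (hmin z h')
      · rw [h']
        exact Or.inr (hmin y h)
      · exact ha1 y h z h'
    · rw [map_add, leadSum_single, ha2, one_smul, hadd]
    · intro hκ y hy
      rcases hsup y hy with rfl | hy
      · omega
      · exact ha3 (by omega) y hy
    · intro hκ y hy
      rcases hsup y hy with rfl | hy
      · omega
      · exact ha4 (by omega) y hy

/-- The torus weight of a monomial in the generators. -/
noncomputable def kapSum : (HElt n m q →₀ ℕ) →+ ℤ := Finsupp.weight kap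

theorem kapSum_eq (a : HElt n m q →₀ ℕ) (j : Fin n) : kapSum a =
    ∑ i, (leadSum a (Sum.inl (i, j)) : ℤ) - ∑ l, (leadSum a (Sum.inr (j, l)) : ℤ) := by
  induction a using Finsupp.induction_linear with
  | zero => simp
  | add f g hf hg =>
    rw [map_add, hf, hg, map_add]
    simp only [Finsupp.add_apply, Nat.cast_add, Finset.sum_add_distrib]
    ring
  | single x k =>
    rw [leadSum_single, kapSum, Finsupp.weight_single, ← sum_ind_sub x j, smul_sub]
    simp only [Finsupp.smul_apply, lead_inl, lead_inr, Finset.smul_sum, nsmul_eq_mul, smul_eq_mul,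
      Nat.cast_mul]

theorem Std.exists_min (hn : 0 < n) {a : HElt n m q →₀ ℕ} (ha : Std a) (h0 : a ≠ 0) :
    ∃ x ∈ a.support, ∀ y ∈ a.support, hle x y := by
  obtain ⟨x, hx, hx'⟩ := a.support.exists_min_image rho (Finsupp.support_nonempty_iff.2 h0)
  refine ⟨x, hx, fun y hy => ?_⟩
  rcases ha x hx y hy with h | h
  · exact h
  · rw [eq_of_hle_of_rho_le hn h (hx' y hy)]
    exact hle_refl hn x

theorem kap_min {a : HElt n m q →₀ ℕ} {x : HElt n m q} (hx : x ∈ a.support)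
    (hmin : ∀ y ∈ a.support, hle x y) : kap x = (kapSum a).sign := by
  have e : kapSum a = ∑ y ∈ a.support, (a y : ℤ) * kap y := by
    simp [kapSum, Finsupp.weight_apply, Finsupp.sum]
  have hax : 0 < a x := Nat.pos_of_ne_zero (Finsupp.mem_support_iff.1 hx)
  have hk : kap x = 1 ∨ kap x = 0 ∨ kap x = -1 := by
    rcases x with I | J | P <;> simp [kap]
  have hk' := fun y hy => kap_of_hle (hmin y hy)
  rcases hk with hk | hk | hk
  · have : 0 < kapSum a := by
      rw [e]
      refine Finset.sum_pos' (fun y hy => ?_) ⟨x, hx, ?_⟩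
      · exact mul_nonneg (Int.natCast_nonneg _) ((hk' y hy).1 (by omega))
      · rw [hk]
        simpa using hax
    rw [Int.sign_eq_one_of_pos this, hk]
  · have : kapSum a = 0 := by
      rw [e]
      refine Finset.sum_eq_zero fun y hy => ?_
      rw [le_antisymm ((hk' y hy).2 (by omega)) ((hk' y hy).1 (by omega)), mul_zero]
    rw [this, hk, Int.sign_zero]
  · have : kapSum a < 0 := by
      rw [e]
      refine Finset.sum_neg' (fun y hy => ?_) ⟨x, hx, ?_⟩
      · exact mul_nonpos_of_nonneg_of_nonpos (Int.natCast_nonneg _) ((hk' y hy).2 (by omega))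
      · rw [hk]
        simpa using hax
    rw [Int.sign_eq_neg_one_of_neg this, hk]

theorem hle_min_of_leadSum_eq (hn : 0 < n) {a b : HElt n m q →₀ ℕ} (hab : leadSum a = leadSum b)
    {x y : HElt n m q} (hx : x ∈ a.support) (hxm : ∀ z ∈ a.support, hle x z)
    (hy : y ∈ b.support) (hym : ∀ z ∈ b.support, hle y z) : hle y x := by
  have hk : kap x = kap y := by
    rw [kap_min hx hxm, kap_min hy hym, kapSum_eq a ⟨0, hn⟩, kapSum_eq b ⟨0, hn⟩, hab]
  rw [hle_iff hn]
  constructor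
  · intro j
    rcases rowv_cases x j with ⟨h1, h2⟩ | h1 | ⟨i, h1, h2⟩
    · rw [hk] at h1
      rcases y with I | J | P
      · simp [kap] at h1
      · exact Nat.zero_le _
      · simp [kap] at h1
    · rw [h1]
      exact rowv_le y j
    · have h3 := lead_le_leadSum hx (Sum.inl (i, j))
      rw [hab] at h3
      obtain ⟨z, hz, hz'⟩ := exists_of_leadSum_ne_zero (show leadSum b (Sum.inl (i, j)) ≠ 0 by omega)
      rw [h1]
      refine (((hle_iff hn _ _).1 (hym z hz)).1 j).trans ?_
      rw [lead_inl, ind] at hz'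
      by_contra hne
      exact hz' (if_neg fun h => hne h.le)
  · intro j
    rcases colv_cases x j with ⟨h1, h2⟩ | h1 | ⟨i, h1, h2⟩
    · rw [hk] at h1
      rcases y with I | J | P
      · exact Nat.zero_le _
      · simp [kap] at h1
      · simp [kap] at h1
    · rw [h1]
      exact colv_le y j
    · have h3 := lead_le_leadSum hx (Sum.inr (j, i))
      rw [hab] at h3
      obtain ⟨z, hz, hz'⟩ := exists_of_leadSum_ne_zero (show leadSum b (Sum.inr (j, i)) ≠ 0 by omega)
      rw [h1]
      refine (((hle_iff hn _ _).1 (hym z hz)).2 j).trans ?_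
      rw [lead_inr, ind] at hz'
      by_contra hne
      exact hz' (if_neg fun h => hne h.le)

theorem leadSum_eq_zero_iff (hn : 0 < n) {a : HElt n m q →₀ ℕ} : leadSum a = 0 ↔ a = 0 := by
  refine ⟨fun h => ?_, fun h => by simp [h]⟩
  by_contra h0
  obtain ⟨x, hx⟩ := Finsupp.support_nonempty_iff.2 h0
  have := lead_le_leadSum hx
  rw [h] at this
  exact lead_ne_zero hn x (le_antisymm this zero_le)

/-- Standard monomials are determined by their expected leading exponents. -/
theorem Std.eq_of_leadSum_eq (hn : 0 < n) {a b : HElt n m q →₀ ℕ} (ha : Std a) (hb : Std b)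
    (hab : leadSum a = leadSum b) : a = b := by
  classical
  induction hd : a.degree using Nat.strong_induction_on generalizing a b with
  | _ d ih =>
    by_cases h0 : a = 0
    · subst h0
      rw [map_zero] at hab
      exact ((leadSum_eq_zero_iff hn).1 hab.symm).symm
    have h0' : b ≠ 0 := by
      rintro rfl
      rw [map_zero] at hab
      exact h0 ((leadSum_eq_zero_iff hn).1 hab)
    obtain ⟨x, hx, hxm⟩ := ha.exists_min hn h0
    obtain ⟨y, hy, hym⟩ := hb.exists_min hn h0'
    have hxy : x = y := hle_antisymm hn (hle_min_of_leadSum_eq hn hab.symm hy hym hx hxm)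
      (hle_min_of_leadSum_eq hn hab hx hxm hy hym)
    subst hxy
    have key : ∀ {c : HElt n m q →₀ ℕ}, Std c → x ∈ c.support →
        Std (c - Finsupp.single x 1) ∧ c - Finsupp.single x 1 + Finsupp.single x 1 = c := by
      intro c hc hx
      refine ⟨fun y hy z hz => hc y (Finsupp.support_tsub hy) z (Finsupp.support_tsub hz),
        tsub_add_cancel_of_le ?_⟩
      rw [Finsupp.single_le_iff]
      exact Nat.one_le_iff_ne_zero.2 (Finsupp.mem_support_iff.1 hx)
    obtain ⟨a1, a2⟩ := key ha hx
    obtain ⟨b1, b2⟩ := key hb hy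
    rw [← a2, ← b2, ih _ ?_ a1 b1 ?_ rfl]
    · rw [← hd, ← a2, map_add, Finsupp.degree_single, a2]
      omega
    · rw [← a2, ← b2, map_add, map_add] at hab
      exact add_right_cancel hab

end Standard

end SMB

set_option linter.unusedSimpArgs false
namespace SMB
open MvPolynomial

section Leading

variable {K : Type} [Field K] {n m q : ℕ}

theorem good_degree {κ : ℤ} {c : (Fin m → ℕ) × (Fin q → ℕ)} {f : KX K n m q}
    (hf : f ∈ tame K n m q κ c) (h0 : f ≠ 0) : Good κ (ord.degree f) :=
  ⟨fun _ _ hj v => degree_row_shear hf h0 hj v, fun _ _ hj v => degree_col_shear hf h0 hj v,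
    fun j => torus_of_mem_tame hf (ord.degree_mem_support h0) j⟩

/-- Total degree in the first column of `U`. -/
def firstCol (hn : 0 < n) (N : Var n m q →₀ ℕ) : ℕ := ∑ i, N (Sum.inl (i, ⟨0, hn⟩))

theorem firstCol_add (hn : 0 < n) (N N' : Var n m q →₀ ℕ) :
    firstCol hn (N + N') = firstCol hn N + firstCol hn N' := by
  simp [firstCol, Finset.sum_add_distrib]

/-- Polynomials of degree at most `d` in the variables of the first column of `U`. -/
noncomputable def firstColLE (K : Type) [Field K] (m q : ℕ) (hn : 0 < n) (d : ℕ) :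
    Submodule K (KX K n m q) :=
  restrictSupport K {N | firstCol hn N ≤ d}

theorem mem_firstColLE {hn : 0 < n} {d : ℕ} {f : KX K n m q} :
    f ∈ firstColLE K m q hn d ↔ ∀ N ∈ f.support, firstCol hn N ≤ d := by
  rw [firstColLE, mem_restrictSupport_iff]
  rfl

theorem firstColLE_mono {hn : 0 < n} {d d' : ℕ} (h : d ≤ d') {f : KX K n m q}
    (hf : f ∈ firstColLE K m q hn d) : f ∈ firstColLE K m q hn d' := by
  rw [mem_firstColLE] at *
  exact fun N hN => (hf N hN).trans h

theorem firstColLE_mul {hn : 0 < n} {d d' : ℕ} {f g : KX K n m q}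
    (hf : f ∈ firstColLE K m q hn d) (hg : g ∈ firstColLE K m q hn d') :
    f * g ∈ firstColLE K m q hn (d + d') := by
  classical
  rw [mem_firstColLE] at *
  intro N hN
  obtain ⟨a, ha, b, hb, rfl⟩ := Finset.mem_add.1 (support_mul f g hN)
  rw [firstCol_add]
  exact Nat.add_le_add (hf a ha) (hg b hb)

theorem firstColLE_one {hn : 0 < n} : (1 : KX K n m q) ∈ firstColLE K m q hn 0 := by
  rw [mem_firstColLE]
  intro N hN
  rw [support_one] at hN
  rw [Finset.mem_singleton.1 hN]
  simp [firstCol]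

theorem firstColLE_prod {hn : 0 < n} {ι : Type} (s : Finset ι) (f : ι → KX K n m q) (d : ι → ℕ)
    (h : ∀ i ∈ s, f i ∈ firstColLE K m q hn (d i)) :
    ∏ i ∈ s, f i ∈ firstColLE K m q hn (∑ i ∈ s, d i) := by
  classical
  induction s using Finset.induction_on with
  | empty => simpa using firstColLE_one
  | insert a s ha ih =>
    rw [Finset.prod_insert ha, Finset.sum_insert ha]
    exact firstColLE_mul (h _ (Finset.mem_insert_self _ _))
      (ih fun i hi => h i (Finset.mem_insert_of_mem hi))

theorem X_inl_mem_firstColLE {hn : 0 < n} (i : Fin m) (j : Fin n) :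
    (X (Sum.inl (i, j)) : KX K n m q) ∈ firstColLE K m q hn (if j.1 = 0 then 1 else 0) := by
  classical
  rw [mem_firstColLE]
  intro N hN
  rw [support_X, Finset.mem_singleton] at hN
  subst hN
  unfold firstCol
  split_ifs with h
  · refine (Finset.sum_le_sum (g := fun i' => if i' = i then 1 else 0) fun i' _ => ?_).trans
      (by simp)
    rw [Finsupp.single_apply]
    split_ifs with h1 h2 <;> simp_all
  · rw [Nat.le_zero, Finset.sum_eq_zero]
    intro i' _
    rw [Finsupp.single_eq_of_ne]
    intro h'
    simp only [Sum.inl.injEq, Prod.mk.injEq] at h'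
    exact h (by rw [← h'.2])

theorem X_inr_mem_firstColLE {hn : 0 < n} (j : Fin n) (l : Fin q) :
    (X (Sum.inr (j, l)) : KX K n m q) ∈ firstColLE K m q hn 0 := by
  classical
  rw [mem_firstColLE]
  intro N hN
  rw [support_X, Finset.mem_singleton] at hN
  subst hN
  simp [firstCol]

theorem firstColLE_det {hn : 0 < n} {ι : Type} [Fintype ι] [DecidableEq ι]
    (A : Matrix ι ι (KX K n m q)) (d : ι → ℕ)
    (h : ∀ i j, A i j ∈ firstColLE K m q hn (d j)) :
    A.det ∈ firstColLE K m q hn (∑ j, d j) := by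
  rw [Matrix.det_apply]
  refine Submodule.sum_mem _ fun τ _ => ?_
  have h1 := firstColLE_prod Finset.univ (fun i => A (τ i) i) d fun i _ => h _ _
  rcases Int.units_eq_one_or (Equiv.Perm.sign τ) with hs | hs <;> rw [hs]
  · simpa using h1
  · rw [Units.neg_smul, one_smul]
    exact Submodule.neg_mem _ h1

/-- Expansion of the determinant of a product along the rows. -/
theorem det_mul_expand {R ι κ : Type} [CommRing R] [Fintype ι] [DecidableEq ι] [Fintype κ]
    [DecidableEq κ] (A : Matrix ι κ R) (B : Matrix κ ι R) :
    (A * B).det = ∑ k : ι → κ, (∏ a, A a (k a)) * (Matrix.of fun a b => B (k a) b).det := by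
  have h : (A * B) = fun a => ∑ k, A a k • B k := by
    funext a b
    simp [Matrix.mul_apply]
  rw [h]
  change Matrix.detRowAlternating (fun a => ∑ k, A a k • B k) = _
  rw [← AlternatingMap.coe_multilinearMap, MultilinearMap.map_sum]
  refine Finset.sum_congr rfl fun k _ => ?_
  rw [MultilinearMap.map_smul_univ]
  rfl

/-- The degree of a generator in the first column of `U`. -/
def dd : HElt n m q → ℕ
  | Sum.inl _ => 1
  | Sum.inr (Sum.inl _) => 0
  | Sum.inr (Sum.inr _) => 1

theorem sum_ite_val_eq_zero (hn : 0 < n) : ∑ j : Fin n, (if j.1 = 0 then 1 else 0) = 1 := by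
  rw [Finset.sum_eq_single ⟨0, hn⟩]
  · simp
  · intro b _ hb
    rw [if_neg]
    exact fun h => hb (Fin.ext h)
  · simp

theorem polyOf_mem_firstColLE (hn : 0 < n) (x : HElt n m q) :
    polyOf K n m q x ∈ firstColLE K m q hn (dd x) := by
  rcases x with I | J | P
  · have := firstColLE_det (hn := hn)
      (Matrix.of fun i j : Fin n => (X (Sum.inl (I.f i, j)) : KX K n m q)) _
      fun i j => X_inl_mem_firstColLE (I.f i) j
    rwa [sum_ite_val_eq_zero hn] at this
  · have := firstColLE_det (hn := hn)
      (Matrix.of fun i j : Fin n => (X (Sum.inr (i, J.f j)) : KX K n m q)) (fun _ => 0)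
      fun i j => X_inr_mem_firstColLE i (J.f j)
    rwa [Finset.sum_const_zero] at this
  · have e : pPoly K n m q P.1 = (((Ugen K n m q).submatrix P.1.rows id) *
        ((Wgen K n m q).submatrix id P.1.cols)).det := rfl
    change pPoly K n m q P.1 ∈ firstColLE K m q hn 1
    rw [e, det_mul_expand]
    refine Submodule.sum_mem _ fun k _ => ?_
    by_cases hk : Function.Injective k
    · refine firstColLE_mono (d := ∑ a, (if (k a).1 = 0 then 1 else 0) + ∑ _b : Fin P.1.s, 0) ?_
        (firstColLE_mul (firstColLE_prod _ _ _ fun a _ => ?_) (firstColLE_det _ _ fun a b => ?_))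
      · rw [Finset.sum_const_zero, add_zero]
        refine le_trans ?_ (sum_ite_val_eq_zero hn).le
        rw [← Finset.sum_image (f := fun j : Fin n => if j.1 = 0 then 1 else 0) hk.injOn]
        exact Finset.sum_le_sum_of_subset (Finset.subset_univ _)
      · exact X_inl_mem_firstColLE _ _
      · exact X_inr_mem_firstColLE _ _
    · simp only [Function.Injective, not_forall] at hk
      obtain ⟨a, b, hab, hne⟩ := hk
      rw [Matrix.det_zero_of_row_eq hne, mul_zero]
      · exact Submodule.zero_mem _
      · funext l
        simp [hab]

theorem tupv_eq_iff {N s : ℕ} {f : Fin s → Fin N} (hf : Function.Injective f)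
    (a : Fin s) (j : Fin n) : tupv n f j = (f a).1 + 1 ↔ j.1 = a.1 := by
  by_cases hj : j.1 < s
  · rw [tupv_of_lt f j hj]
    constructor
    · intro h
      exact congrArg Fin.val (hf (Fin.ext (Nat.succ.inj h)))
    · intro h
      congr 3
      exact Fin.ext h
  · rw [tupv_of_ge f j hj]
    have := (f a).2
    have := a.2
    omega

theorem polyOf_ne_zero (x : HElt n m q) : polyOf K n m q x ≠ 0 := by
  intro h0
  have h := congrArg (aeval fun t => ((lead x t : ℕ) : K)) h0
  rw [map_zero] at h
  rcases x with I | J | P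
  · rw [polyOf, aeval_uPoly] at h
    have e : (uMat fun t => ((lead (Sum.inl I : HElt n m q) t : ℕ) : K)).submatrix I.f id = 1 := by
      refine Matrix.ext fun a b => ?_
      simp only [uMat, Matrix.submatrix_apply, Matrix.of_apply, id, lead_inl, ind, rowv,
        tupv_eq_iff I.mono.injective, Matrix.one_apply, Fin.ext_iff, eq_comm]
      split_ifs <;> simp
    rw [e, Matrix.det_one] at h
    exact one_ne_zero h
  · rw [polyOf, aeval_xiPoly] at h
    have e : (wMat fun t => ((lead (Sum.inr (Sum.inl J) : HElt n m q) t : ℕ) : K)).submatrix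
        id J.f = 1 := by
      refine Matrix.ext fun a b => ?_
      simp only [wMat, Matrix.submatrix_apply, Matrix.of_apply, id, lead_inr, ind, colv,
        tupv_eq_iff J.mono.injective, Matrix.one_apply, Fin.ext_iff]
      split_ifs <;> simp
    rw [e, Matrix.det_one] at h
    exact one_ne_zero h
  · rw [polyOf, aeval_pPoly] at h
    have e : ((uMat fun t => ((lead (Sum.inr (Sum.inr P) : HElt n m q) t : ℕ) : K)) *
        (wMat fun t => ((lead (Sum.inr (Sum.inr P) : HElt n m q) t : ℕ) : K))).submatrix
        P.1.rows P.1.cols = 1 := by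
      refine Matrix.ext fun a b => ?_
      simp only [uMat, wMat, Matrix.submatrix_apply, Matrix.mul_apply, Matrix.of_apply, lead_inl,
        lead_inr, ind, rowv, colv, tupv_eq_iff P.1.rmono.injective,
        tupv_eq_iff P.1.cmono.injective, Matrix.one_apply, Fin.ext_iff]
      rw [Finset.sum_eq_single (Fin.castLE P.2.2 a)]
      · simp
      · intro j _ hj
        have : ¬ j.1 = a.1 := fun h => hj (Fin.ext h)
        simp [this]
      · simp
    rw [e, Matrix.det_one] at h
    exact one_ne_zero h

end Leading

end SMB

set_option linter.unusedSimpArgs false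
namespace SMB
open MvPolynomial

section Leading

variable {K : Type} [Field K] {n m q : ℕ}

theorem sum_ind_row {N s : ℕ} (hs : s ≤ n) (f : Fin s → Fin N) (i : Fin N) :
    ∑ j, ind N (tupv n f) i j = (∑ k, Pi.single (f k) 1 : Fin N → ℕ) i := by
  rw [Finset.sum_apply]
  symm
  refine Finset.sum_of_injOn (Fin.castLE hs) (Fin.castLE_injective hs).injOn (by simp) ?_ ?_
  · intro j _ hj
    have : ¬ j.1 < s := fun h => hj ⟨⟨j.1, h⟩, by simp, rfl⟩
    rw [ind, tupv_of_ge f j this, if_neg (by omega)]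
  · intro k _
    rw [ind, tupv_of_lt f _ (by simp), Pi.single_apply]
    congr 1
    simp [Fin.ext_iff, eq_comm]

theorem eq_of_sum_single_eq {N s s' : ℕ} {f : Fin s → Fin N} {g : Fin s' → Fin N}
    (hf : StrictMono f) (hg : StrictMono g)
    (h : (∑ k, Pi.single (f k) 1 : Fin N → ℕ) = ∑ k, Pi.single (g k) 1) :
    ∃ e : s = s', f = g ∘ Fin.cast e := by
  have tot : ∀ {r : ℕ} (f : Fin r → Fin N), ∑ i, (∑ k, Pi.single (f k) 1 : Fin N → ℕ) i = r := by
    intro r f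
    simp only [Finset.sum_apply]
    rw [Finset.sum_comm]
    simp
  have mem : ∀ {r : ℕ} (f : Fin r → Fin N) (i : Fin N),
      i ∈ Set.range f ↔ (∑ k, Pi.single (f k) 1 : Fin N → ℕ) i ≠ 0 := by
    intro r f i
    rw [Finset.sum_apply, Ne, Finset.sum_eq_zero_iff]
    simp [Pi.single_apply, eq_comm]
  have e : s = s' := by rw [← tot f, ← tot g, h]
  subst e
  refine ⟨rfl, (StrictMono.range_inj hf hg).1 ?_⟩
  ext i
  rw [mem, mem, h]

theorem weight_varWt_lead (x : HElt n m q) :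
    Finsupp.weight varWt (lead x) = ((fun _ => kap x), cont x) := by
  refine Prod.ext (funext fun j => ?_) (Prod.ext (funext fun i => ?_) (funext fun l => ?_))
  · rw [weight_varWt_torus]
    exact sum_ind_sub x j
  · rw [weight_varWt_row]
    simp only [lead_inl]
    rcases x with I | J | P
    · exact sum_ind_row le_rfl _ _
    · simp [rowv, ind_zero, cont]
    · exact sum_ind_row P.2.2 _ _
  · rw [weight_varWt_col]
    simp only [lead_inr]
    rcases x with I | J | P
    · simp [colv, ind_zero, cont]
    · exact sum_ind_row le_rfl _ _
    · exact sum_ind_row P.2.2 _ _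

theorem eq_of_kap_cont {x y : HElt n m q} (h1 : kap x = kap y) (h2 : cont x = cont y) : x = y := by
  have inc : ∀ {N : ℕ} (I I' : IncTup n N),
      (∑ k, Pi.single (I.f k) 1 : Fin N → ℕ) = ∑ k, Pi.single (I'.f k) 1 → I = I' := by
    rintro N ⟨f, hf⟩ ⟨g, hg⟩ h
    obtain ⟨_, h⟩ := eq_of_sum_single_eq hf hg h
    have h : f = g := h
    subst h
    rfl
  rcases x with I | J | ⟨⟨s, r, c, hr, hc⟩, hP⟩ <;>
    rcases y with I' | J' | ⟨⟨s', r', c', hr', hc'⟩, hP'⟩ <;> simp only [kap] at h1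
  · rw [inc I I' (congrArg Prod.fst h2)]
  · omega
  · omega
  · omega
  · rw [inc J J' (congrArg Prod.snd h2)]
  · omega
  · omega
  · omega
  · obtain ⟨e, h3⟩ := eq_of_sum_single_eq hr hr' (congrArg Prod.fst h2)
    obtain ⟨_, h4⟩ := eq_of_sum_single_eq hc hc' (congrArg Prod.snd h2)
    subst e
    have h3 : r = r' := h3
    have h4 : c = c' := h4
    subst h3
    subst h4
    rfl

theorem cont_ne_zero (hn : 0 < n) (x : HElt n m q) : cont x ≠ 0 := by
  have key : ∀ {N s : ℕ} (f : Fin s → Fin N), 0 < s → (∑ k, Pi.single (f k) 1 : Fin N → ℕ) ≠ 0 := by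
    intro N s f hs h
    have := congrFun h (f ⟨0, hs⟩)
    rw [Finset.sum_apply, Pi.zero_apply, Finset.sum_eq_zero_iff] at this
    simpa using this ⟨0, hs⟩ (Finset.mem_univ _)
  intro h
  rcases x with I | J | P
  · exact key I.f hn (congrArg Prod.fst h)
  · exact key J.f hn (congrArg Prod.snd h)
  · exact key P.1.rows P.2.1 (congrArg Prod.fst h)

/-- Row and column content of a monomial in the generators. -/
noncomputable def contSum : (HElt n m q →₀ ℕ) →+ (Fin m → ℕ) × (Fin q → ℕ) := Finsupp.weight cont

/-- Degree in the first column of `U` of a monomial in the generators. -/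
noncomputable def ddSum : (HElt n m q →₀ ℕ) →+ ℕ := Finsupp.weight dd

theorem weight_varWt_leadSum (a : HElt n m q →₀ ℕ) :
    Finsupp.weight varWt (leadSum a) = ((fun _ => kapSum a), contSum a) := by
  induction a using Finsupp.induction_linear with
  | zero => simp; rfl
  | add f g hf hg =>
    rw [map_add, map_add, hf, hg, map_add, map_add]
    rfl
  | single x k =>
    rw [leadSum_single, map_nsmul, weight_varWt_lead, kapSum, contSum, Finsupp.weight_single,
      Finsupp.weight_single]
    rfl

theorem firstCol_lead (hn : 0 < n) (x : HElt n m q) : firstCol hn (lead x) = dd x := by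
  unfold firstCol
  simp only [lead_inl]
  rcases x with I | J | P
  · exact (sum_ind_tupv _ _).trans (if_pos hn)
  · simp [rowv, ind_zero, dd]
  · exact (sum_ind_tupv _ _).trans (if_pos P.2.1)

theorem firstCol_leadSum (hn : 0 < n) (a : HElt n m q →₀ ℕ) :
    firstCol hn (leadSum a) = ddSum a := by
  induction a using Finsupp.induction_linear with
  | zero => simp [firstCol]
  | add f g hf hg => rw [map_add, firstCol_add, hf, hg, map_add]
  | single x k =>
    rw [leadSum_single, ddSum, Finsupp.weight_single, ← firstCol_lead hn]
    simp [firstCol, Finset.mul_sum]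

theorem degree_le_of_kap_nonneg {a : HElt n m q →₀ ℕ} (h : ∀ x ∈ a.support, 0 ≤ kap x) :
    a.degree = ddSum a := by
  rw [ddSum, Finsupp.weight_apply, Finsupp.degree_apply, Finsupp.sum]
  refine Finset.sum_congr rfl fun x hx => ?_
  have := h x hx
  rcases x with I | J | P <;> simp_all [kap, dd]

theorem degree_le_of_kap_nonpos {a : HElt n m q →₀ ℕ} (h : ∀ x ∈ a.support, kap x ≤ 0) :
    (a.degree : ℤ) = ddSum a - kapSum a := by
  rw [ddSum, kapSum, Finsupp.weight_apply, Finsupp.weight_apply, Finsupp.degree_apply, Finsupp.sum,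
    Finsupp.sum, Nat.cast_sum, Nat.cast_sum, ← Finset.sum_sub_distrib]
  refine Finset.sum_congr rfl fun x hx => ?_
  have := h x hx
  rcases x with I | J | P <;> simp_all [kap, dd]

theorem degree_polyOf (hn : 0 < n) (x : HElt n m q) : ord.degree (polyOf K n m q x) = lead x := by
  have ht := polyOf_mem_tame (K := K) x
  have hM := ord.degree_mem_support (polyOf_ne_zero (K := K) x)
  obtain ⟨a, ha, hlead, hpos, hneg⟩ := exists_std_of_good hn (good_degree ht (polyOf_ne_zero x))
  have hw := weight_eq_of_mem_tame ht hM
  have hd := mem_firstColLE.1 (polyOf_mem_firstColLE hn x) _ hM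
  rw [← hlead] at hw hd ⊢
  rw [weight_varWt_leadSum] at hw
  rw [firstCol_leadSum] at hd
  have hk : kapSum a = kap x := congrFun (congrArg Prod.fst hw) ⟨0, hn⟩
  have hc : contSum a = cont x := congrArg Prod.snd hw
  have hdeg : a.degree ≤ 1 := by
    rcases x with I | J | P
    · rw [degree_le_of_kap_nonneg (hpos (by simp [kap]))]
      exact hd
    · have := degree_le_of_kap_nonpos (hneg (by simp [kap]))
      rw [hk] at this
      simp only [kap, dd] at this hd
      omega
    · rw [degree_le_of_kap_nonneg (hpos (by simp [kap]))]
      exact hd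
  have h0 : a ≠ 0 := by
    rintro rfl
    rw [map_zero] at hc
    exact cont_ne_zero hn x hc.symm
  have h1 : a.degree = 1 := by
    have : a.degree ≠ 0 := by rwa [Ne, Finsupp.degree_eq_zero_iff]
    omega
  obtain ⟨y, rfl⟩ := (Finsupp.range_single_one (σ := HElt n m q)).ge h1
  rw [leadSum_single, one_smul]
  rw [kapSum, Finsupp.weight_single, one_smul] at hk
  rw [contSum, Finsupp.weight_single, one_smul] at hc
  rw [eq_of_kap_cont hk hc]

end Leading

end SMB

namespace SMB
open MvPolynomial

section Triangular

variable {K : Type} [Field K] {n m q : ℕ}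

/-- The product of generators with given exponents. -/
noncomputable def gen (K : Type) [Field K] (a : HElt n m q →₀ ℕ) : KX K n m q :=
  piSL K n m q (monomial a 1)

theorem gen_zero : gen K (0 : HElt n m q →₀ ℕ) = 1 := map_one _

theorem gen_add (a b : HElt n m q →₀ ℕ) : gen K (a + b) = gen K a * gen K b := by
  rw [gen, gen, gen, ← map_mul, monomial_mul, one_mul]

theorem gen_single (x : HElt n m q) : gen K (Finsupp.single x 1) = polyOf K n m q x :=
  aeval_X _ _

theorem gen_induction {p : (HElt n m q →₀ ℕ) → Prop} (h0 : p 0)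
    (h1 : ∀ x, p (Finsupp.single x 1)) (h2 : ∀ a b, p a → p b → p (a + b)) (a) : p a := by
  induction a using Finsupp.induction_linear with
  | zero => exact h0
  | add f g hf hg => exact h2 f g hf hg
  | single x k =>
    induction k with
    | zero => simpa using h0
    | succ k ih =>
      rw [Finsupp.single_add]
      exact h2 _ _ ih (h1 x)

theorem gen_ne_zero (a : HElt n m q →₀ ℕ) : gen K a ≠ 0 := by
  induction a using gen_induction with
  | h0 => exact gen_zero (K := K) ▸ one_ne_zero
  | h1 x => exact gen_single (K := K) x ▸ polyOf_ne_zero x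
  | h2 a b ha hb => exact gen_add (K := K) a b ▸ mul_ne_zero ha hb

theorem degree_gen (hn : 0 < n) (a : HElt n m q →₀ ℕ) : ord.degree (gen K a) = leadSum a := by
  induction a using gen_induction with
  | h0 => rw [gen_zero, map_zero, ord.degree_one]
  | h1 x => rw [gen_single, leadSum_single, one_smul, degree_polyOf hn]
  | h2 a b ha hb => rw [gen_add, ord.degree_mul (gen_ne_zero a) (gen_ne_zero b), ha, hb, map_add]

theorem gen_mem_tame (a : HElt n m q →₀ ℕ) : gen K a ∈ tame K n m q (kapSum a) (contSum a) := by
  induction a using gen_induction with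
  | h0 =>
    rw [gen_zero, map_zero, map_zero]
    exact tame_one
  | h1 x =>
    rw [gen_single, kapSum, contSum, Finsupp.weight_single, Finsupp.weight_single, one_smul,
      one_smul]
    exact polyOf_mem_tame x
  | h2 a b ha hb =>
    rw [gen_add, map_add, map_add]
    exact tame_mul ha hb

theorem gen_mem_firstColLE (hn : 0 < n) (a : HElt n m q →₀ ℕ) :
    gen K a ∈ firstColLE K m q hn (ddSum a) := by
  induction a using gen_induction with
  | h0 =>
    rw [gen_zero, map_zero]
    exact firstColLE_one
  | h1 x =>
    rw [gen_single, ddSum, Finsupp.weight_single, one_smul]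
    exact polyOf_mem_firstColLE hn x
  | h2 a b ha hb =>
    rw [gen_add, map_add]
    exact firstColLE_mul ha hb

theorem piSL_eq_sum (F : MvPolynomial (HElt n m q) K) :
    piSL K n m q F = ∑ a ∈ F.support, coeff a F • gen K a := by
  conv_lhs => rw [F.as_sum, map_sum]
  refine Finset.sum_congr rfl fun a _ => ?_
  rw [gen, ← map_smul, smul_monomial, smul_eq_mul, mul_one]

/-- A nonzero combination of standard monomials has a leading exponent which is maximal for the
degree in the first column of `U`. -/
theorem exists_leadSum_mem_support (hn : 0 < n) {F : MvPolynomial (HElt n m q) K} (h0 : F ≠ 0)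
    (hF : ∀ a ∈ F.support, Std a) :
    ∃ a ∈ F.support, (∀ b ∈ F.support, ddSum b ≤ ddSum a) ∧
      leadSum a ∈ (piSL K n m q F).support := by
  obtain ⟨a, ha, hmax⟩ := F.support.exists_max_image
    (fun a => toLex (ddSum a, ord.toSyn (leadSum a))) (support_nonempty.2 h0)
  simp only [Prod.Lex.toLex_le_toLex] at hmax
  refine ⟨a, ha, fun b hb => (hmax b hb).elim le_of_lt fun h => h.1.le, ?_⟩
  rw [mem_support_iff, piSL_eq_sum, coeff_sum, Finset.sum_eq_single a]
  · rw [coeff_smul, smul_eq_mul, ← degree_gen (K := K) hn]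
    exact mul_ne_zero (mem_support_iff.1 ha) (ord.leadingCoeff_ne_zero_iff.2 (gen_ne_zero a))
  · intro b hb hba
    rw [coeff_smul, smul_eq_mul]
    refine mul_eq_zero_of_right _ ?_
    rcases hmax b hb with h | ⟨-, h⟩
    · by_contra hc
      have := mem_firstColLE.1 (gen_mem_firstColLE (K := K) hn b) _ (mem_support_iff.2 hc)
      rw [firstCol_leadSum] at this
      omega
    · apply ord.coeff_eq_zero_of_lt
      rw [degree_gen hn]
      refine lt_of_le_of_ne h fun he => hba ?_
      exact (hF b hb).eq_of_leadSum_eq hn (hF a ha) (ord.toSyn.injective he)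
  · intro h
    exact absurd ha h

theorem eq_zero_of_piSL_eq_zero (hn : 0 < n) {F : MvPolynomial (HElt n m q) K}
    (hF : ∀ a ∈ F.support, Std a) (h : piSL K n m q F = 0) : F = 0 := by
  by_contra h0
  obtain ⟨a, -, -, ha⟩ := exists_leadSum_mem_support hn h0 hF
  rw [h] at ha
  simp at ha

theorem ddSum_le_of_piSL_mem (hn : 0 < n) {F : MvPolynomial (HElt n m q) K} {d : ℕ}
    (hF : ∀ a ∈ F.support, Std a) (h : piSL K n m q F ∈ firstColLE K m q hn d) :
    ∀ a ∈ F.support, ddSum a ≤ d := by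
  intro b hb
  obtain ⟨a, -, ha, ha'⟩ := exists_leadSum_mem_support hn (by rintro rfl; simp at hb) hF
  rw [← firstCol_leadSum hn] at ha
  exact (ha b hb).trans (mem_firstColLE.1 h _ ha')

/-- Shear invariants with fixed weights are combinations of standard monomials. -/
theorem exists_piSL_eq (hn : 0 < n) {κ : ℤ} {c : (Fin m → ℕ) × (Fin q → ℕ)} (f : KX K n m q)
    (hf : f ∈ tame K n m q κ c) :
    ∃ F : MvPolynomial (HElt n m q) K, piSL K n m q F = f ∧ ∀ a ∈ F.support, Std a ∧
      kapSum a = κ ∧ contSum a = c ∧ ord.toSyn (leadSum a) ≤ ord.toSyn (ord.degree f) ∧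
      (0 ≤ κ → ∀ x ∈ a.support, 0 ≤ kap x) ∧ (κ ≤ 0 → ∀ x ∈ a.support, kap x ≤ 0) := by
  classical
  induction hd : ord.toSyn (ord.degree f) using WellFoundedLT.induction generalizing f with
  | _ d ih =>
    by_cases h0 : f = 0
    · exact ⟨0, by simp [h0], by simp⟩
    obtain ⟨a, ha, hlead, hpos, hneg⟩ := exists_std_of_good hn (good_degree hf h0)
    have hw := weight_eq_of_mem_tame hf (ord.degree_mem_support h0)
    rw [← hlead, weight_varWt_leadSum] at hw
    have hk : kapSum a = κ := congrFun (congrArg Prod.fst hw) ⟨0, hn⟩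
    have hc : contSum a = c := congrArg Prod.snd hw
    have hl : ord.leadingCoeff (gen K a) ≠ 0 := ord.leadingCoeff_ne_zero_iff.2 (gen_ne_zero a)
    set r := ord.leadingCoeff f / ord.leadingCoeff (gen K a) with hr
    have hrep : ∀ g : KX K n m q, g = f - r • gen K a →
        ∃ F : MvPolynomial (HElt n m q) K, piSL K n m q F = g ∧ ∀ a ∈ F.support, Std a ∧
      kapSum a = κ ∧ contSum a = c ∧ ord.toSyn (leadSum a) ≤ d ∧
      (0 ≤ κ → ∀ x ∈ a.support, 0 ≤ kap x) ∧ (κ ≤ 0 → ∀ x ∈ a.support, kap x ≤ 0) := by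
      intro g hg
      by_cases hg0 : g = 0
      · exact ⟨0, by simp [hg0], by simp⟩
      have hgt : g ∈ tame K n m q κ c := by
        rw [hg]
        refine Submodule.sub_mem _ hf (Submodule.smul_mem _ _ ?_)
        rw [← hk, ← hc]
        exact gen_mem_tame a
      have hlt : ord.toSyn (ord.degree g) < d := by
        rw [← hd]
        refine lt_of_le_of_ne ?_ ?_
        · rw [hg]
          refine ord.degree_sub_le.trans (sup_le le_rfl ?_)
          refine ord.degree_smul_le.trans ?_
          rw [degree_gen hn, hlead]
        · intro he
          have h1 := ord.leadingCoeff_ne_zero_iff.2 hg0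
          rw [MonomialOrder.leadingCoeff, ord.toSyn.injective he, hg, coeff_sub, coeff_smul] at h1
          apply h1
          have h2 : coeff (ord.degree f) (gen K a) = ord.leadingCoeff (gen K a) := by
            rw [MonomialOrder.leadingCoeff, degree_gen hn, hlead]
          rw [h2, smul_eq_mul, hr, div_mul_cancel₀ _ hl]
          exact sub_self _
      obtain ⟨F, hF, hF'⟩ := ih _ hlt g hgt rfl
      refine ⟨F, hF, fun b hb => ?_⟩
      obtain ⟨e1, e2, e3, e4, e5⟩ := hF' b hb
      exact ⟨e1, e2, e3, e4.trans hlt.le, e5⟩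
    obtain ⟨F, hF, hF'⟩ := hrep _ rfl
    refine ⟨F + r • monomial a 1, ?_, fun b hb => ?_⟩
    · rw [map_add, map_smul, hF]
      exact sub_add_cancel _ _
    · rcases Finset.mem_union.1 (support_add hb) with hb | hb
      · exact hF' b hb
      · have hb := support_smul hb
        rw [support_monomial, if_neg one_ne_zero, Finset.mem_singleton] at hb
        subst hb
        exact ⟨ha, hk, hc, by rw [hlead, hd], hpos, hneg⟩

end Triangular

end SMB

namespace SMB
open MvPolynomial

section Straightening

variable {K : Type} [Field K] {n m q : ℕ}

theorem exists_eq_of_degree_le_two {a : HElt n m q →₀ ℕ} (h0 : a ≠ 0) (h2 : a.degree ≤ 2)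
    (ha : Std a) :
    ∃ (o : Option (HElt n m q)) (w : HElt n m q),
      a = (o.elim 0 fun z => Finsupp.single z 1) + Finsupp.single w 1 ∧
        ∀ z, o = some z → hle w z := by
  obtain ⟨w, hw⟩ := Finsupp.ne_iff.1 h0
  have hle1 : Finsupp.single w 1 ≤ a := by
    rw [Finsupp.single_le_iff]
    exact Nat.one_le_iff_ne_zero.2 hw
  obtain ⟨b, rfl⟩ := exists_add_of_le hle1
  rw [map_add, Finsupp.degree_single] at h2
  rcases Nat.eq_zero_or_pos b.degree with hb | hb
  · rw [Finsupp.degree_eq_zero_iff] at hb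
    subst hb
    exact ⟨none, w, by simp, by simp⟩
  · obtain ⟨z, rfl⟩ := (Finsupp.range_single_one (σ := HElt n m q)).ge
      (show b.degree = 1 by omega)
    have h := ha w (by simp) z (by simp)
    rcases h with h | h
    · exact ⟨some z, w, by rw [add_comm]; rfl, by rintro _ ⟨⟩; exact h⟩
    · exact ⟨some w, z, rfl, by rintro _ ⟨⟩; exact h⟩

theorem degree_eq_of_kap (x y : HElt n m q) :
    (0 ≤ kap x + kap y → dd x + dd y ≤ 2) ∧
    (((dd x + dd y : ℕ) : ℤ) - (kap x + kap y) ≤ 2) := by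
  rcases x with I | J | P <;> rcases y with I' | J' | P' <;> simp [dd, kap]

/-- The product of two generators is a combination of standard monomials of degree at most two. -/
theorem exists_straightening (hn : 0 < n) (x y : HElt n m q) :
    ∃ F : MvPolynomial (HElt n m q) K, piSL K n m q F = polyOf K n m q x * polyOf K n m q y ∧
      ∀ a ∈ F.support, Std a ∧ a ≠ 0 ∧ a.degree ≤ 2 ∧
        ord.toSyn (leadSum a) ≤ ord.toSyn (lead x + lead y) := by
  obtain ⟨F, hF, h⟩ := exists_piSL_eq hn _
    (tame_mul (polyOf_mem_tame (K := K) x) (polyOf_mem_tame (K := K) y))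
  refine ⟨F, hF, fun a ha => ?_⟩
  have hdd := ddSum_le_of_piSL_mem hn (fun b hb => (h b hb).1)
    (hF ▸ firstColLE_mul (polyOf_mem_firstColLE hn x) (polyOf_mem_firstColLE hn y)) a ha
  obtain ⟨h1, h2, h3, h4, h5, h6⟩ := h a ha
  rw [ord.degree_mul (polyOf_ne_zero x) (polyOf_ne_zero y), degree_polyOf hn,
    degree_polyOf hn] at h4
  refine ⟨h1, ?_, ?_, h4⟩
  · rintro rfl
    rw [map_zero] at h3
    exact cont_ne_zero hn x (by
      have := congrArg Prod.fst h3
      have h' := congrArg Prod.snd h3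
      ext i
      · have := congrFun this i
        simp only [Prod.fst_zero, Prod.fst_add, Pi.zero_apply, Pi.add_apply] at this ⊢
        omega
      · have := congrFun h' i
        simp only [Prod.snd_zero, Prod.snd_add, Pi.zero_apply, Pi.add_apply] at this ⊢
        omega)
  · have hk := degree_eq_of_kap x y
    rcases le_total 0 (kap x + kap y) with hs | hs
    · rw [degree_le_of_kap_nonneg (h5 hs)]
      exact hdd.trans (hk.1 hs)
    · have := degree_le_of_kap_nonpos (h6 hs)
      rw [h2] at this
      omega

variable (K) in
/-- The standard representation of the product of two generators. -/
noncomputable def strF (hn : 0 < n) (x y : HElt n m q) : MvPolynomial (HElt n m q) K :=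
  (exists_straightening hn x y).choose

theorem piSL_strF (hn : 0 < n) (x y : HElt n m q) :
    piSL K n m q (strF K hn x y) = polyOf K n m q x * polyOf K n m q y :=
  (exists_straightening hn x y).choose_spec.1

theorem strF_support (hn : 0 < n) (x y : HElt n m q) : ∀ a ∈ (strF K hn x y).support,
    Std a ∧ a ≠ 0 ∧ a.degree ≤ 2 ∧ ord.toSyn (leadSum a) ≤ ord.toSyn (lead x + lead y) :=
  (exists_straightening hn x y).choose_spec.2

theorem straightElt_strF (hn : 0 < n) (x y : HElt n m q) :
    SLStraightElt K x y (X x * X y - strF K hn x y) := by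
  classical
  set F := strF K hn x y with hF
  have h : ∀ a : F.support, ∃ s : Option (HElt n m q) × HElt n m q,
      a.1 = (s.1.elim 0 fun z => Finsupp.single z 1) + Finsupp.single s.2 1 ∧
        ∀ z, s.1 = some z → hle s.2 z := by
    intro a
    obtain ⟨h1, h2, h3, -⟩ := strF_support hn x y a.1 a.2
    obtain ⟨o, w, h⟩ := exists_eq_of_degree_le_two h2 h3 h1
    exact ⟨(o, w), h⟩
  choose e he he' using h
  set mon : Option (HElt n m q) × HElt n m q → (HElt n m q →₀ ℕ) := fun s =>
    (s.1.elim 0 fun z => Finsupp.single z 1) + Finsupp.single s.2 1 with hmon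
  have hinj : Function.Injective e := fun a b hab =>
    Subtype.ext ((he a).trans ((congrArg mon hab).trans (he b).symm))
  refine ⟨Finset.univ.image e, fun s => coeff (mon s) F, ?_, ?_⟩
  · rw [Finset.sum_image hinj.injOn]
    congr 1
    conv_lhs => rw [F.as_sum, ← Finset.sum_coe_sort]
    refine Finset.sum_congr rfl fun a _ => ?_
    have h1 : ((e a).1.elim 1 fun z => X z) * X (e a).2 = monomial (R := K) (mon (e a)) 1 := by
      rw [hmon]
      beta_reduce
      rcases (e a).1 with _ | z
      · simp [X]
      · simp [X, monomial_mul]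
    rw [h1, smul_monomial, smul_eq_mul, mul_one]
    exact congrArg (fun b => monomial b (coeff b F)) (he a)
  · intro s hs
    obtain ⟨a, -, rfl⟩ := Finset.mem_image.1 hs
    refine ⟨?_, he' a⟩
    have : coeff a.1 F ≠ 0 := mem_support_iff.1 a.2
    rwa [he a] at this

end Straightening

end SMB

namespace SMB
open MvPolynomial

section Termination

variable {K : Type} [Field K] {n m q : ℕ}

theorem pair_le_of_count_eq {N a b c d : ℕ} (ha : a ≤ N + 1) (hb : b ≤ N + 1) (hc : c ≤ N + 1)
    (hd : d ≤ N + 1) (hab : a ≤ b)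
    (h : ∀ v ≤ N, (if a = v then 1 else 0) + (if b = v then 1 else 0) =
      (if c = v then 1 else 0) + (if d = v then 1 else 0)) :
    a ≤ c ∧ a ≤ d ∧ a + b = c + d := by
  have key : (a = c ∧ b = d) ∨ (a = d ∧ b = c) := by
    have h1 := h a
    have h2 := h b
    have h3 := h c
    have h4 := h d
    clear h
    grind
  omega

theorem ite_rowv_add_dd (x : HElt n m q) (j : Fin n) :
    (if rowv x j = 0 then 1 else 0) + dd x = 1 := by
  rcases x with I | J | P
  · have := one_le_tupv (n := n) I.f j
    rw [rowv, dd, if_neg (by omega)]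
  · simp [rowv, dd]
  · have := one_le_tupv (n := n) P.1.rows j
    rw [rowv, dd, if_neg (by omega)]

theorem ite_colv_add_dd (x : HElt n m q) (j : Fin n) :
    ((if colv x j = 0 then 1 else 0 : ℕ) : ℤ) + dd x - kap x = 1 := by
  rcases x with I | J | P
  · simp [colv, dd, kap]
  · have := one_le_tupv (n := n) J.f j
    rw [colv, dd, kap, if_neg (by omega)]
    simp
  · have := one_le_tupv (n := n) P.1.cols j
    rw [colv, dd, kap, if_neg (by omega)]
    simp

theorem isUXiPair_of_single {x y z : HElt n m q} (hd : dd z = dd x + dd y)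
    (hk : kap z = kap x + kap y) : isUXiPair x y := by
  rcases x with I | J | P <;> rcases y with I' | J' | P' <;> rcases z with I'' | J'' | P'' <;>
    simp_all [dd, kap, isUXiPair]

/-- If `w ≤ z` have the same combined leading exponent as `x`, `y`, then `w ≤ x, y`. -/
theorem hle_of_lead_add_eq (hn : 0 < n) {x y z w : HElt n m q} (hwz : hle w z)
    (h : lead w + lead z = lead x + lead y) (hd : dd w + dd z = dd x + dd y)
    (hk : kap w + kap z = kap x + kap y) :
    hle w x ∧ hle w y ∧ rho w + rho z = rho x + rho y := by
  rw [hle_iff hn] at hwz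
  have hr : ∀ j, rowv w j ≤ rowv x j ∧ rowv w j ≤ rowv y j ∧
      rowv w j + rowv z j = rowv x j + rowv y j := fun j => by
    refine pair_le_of_count_eq (rowv_le w j) (rowv_le z j) (rowv_le x j) (rowv_le y j)
      (hwz.1 j) fun v hv => ?_
    rcases v with _ | v
    · have h1 := ite_rowv_add_dd w j
      have h2 := ite_rowv_add_dd x j
      have h3 := ite_rowv_add_dd y j
      have h4 := ite_rowv_add_dd z j
      omega
    · have := DFunLike.congr_fun h (Sum.inl (⟨v, hv⟩, j))
      simpa only [Finsupp.add_apply, lead_inl, ind] using this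
  have hc : ∀ j, colv w j ≤ colv x j ∧ colv w j ≤ colv y j ∧
      colv w j + colv z j = colv x j + colv y j := fun j => by
    refine pair_le_of_count_eq (colv_le w j) (colv_le z j) (colv_le x j) (colv_le y j)
      (hwz.2 j) fun v hv => ?_
    rcases v with _ | v
    · have h1 := ite_colv_add_dd w j
      have h2 := ite_colv_add_dd x j
      have h3 := ite_colv_add_dd y j
      have h4 := ite_colv_add_dd z j
      omega
    · have := DFunLike.congr_fun h (Sum.inr (j, ⟨v, hv⟩))
      simpa only [Finsupp.add_apply, lead_inr, ind] using this
  refine ⟨(hle_iff hn _ _).2 ⟨fun j => (hr j).1, fun j => (hc j).1⟩,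
    (hle_iff hn _ _).2 ⟨fun j => (hr j).2.1, fun j => (hc j).2.1⟩, ?_⟩
  rw [rho, rho, rho, rho, ← Finset.sum_add_distrib, ← Finset.sum_add_distrib]
  refine Finset.sum_congr rfl fun j _ => ?_
  have h1 := (hr j).2.2
  have h2 := (hc j).2.2
  omega

/-- The defect of the square of `rho` from its maximal possible value. -/
def defect (x : HElt n m q) : ℕ := (n * (m + q + 2)) ^ 2 - rho x ^ 2

theorem defect_add (x : HElt n m q) : defect x + rho x ^ 2 = (n * (m + q + 2)) ^ 2 :=
  Nat.sub_add_cancel (Nat.pow_le_pow_left (rho_le x) 2)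

/-- The total defect of a monomial. -/
noncomputable def defectSum : (HElt n m q →₀ ℕ) →+ ℕ := Finsupp.weight defect

theorem defectSum_single (x : HElt n m q) : defectSum (Finsupp.single x 1) = defect x := by
  rw [defectSum, Finsupp.weight_single, one_smul]

theorem rho_lt_of_hle (hn : 0 < n) {w x : HElt n m q} (h : hle w x) (hne : w ≠ x) :
    rho w < rho x := by
  by_contra hc
  exact hne (eq_of_hle_of_rho_le hn h (not_lt.1 hc))

theorem defectSum_lt (hn : 0 < n) {x y : HElt n m q} (hxy : ¬ hle x y) (hyx : ¬ hle y x)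
    (hp : ¬ isUXiPair x y) {a : HElt n m q →₀ ℕ} (ha : Std a) (h0 : a ≠ 0) (h2 : a.degree ≤ 2)
    (h : leadSum a = lead x + lead y) : defectSum a < defect x + defect y := by
  have h' : leadSum a = leadSum (Finsupp.single x 1 + Finsupp.single y 1) := by
    rw [h, map_add, leadSum_single, leadSum_single, one_smul, one_smul]
  have hd : ddSum a = dd x + dd y := by
    rw [← firstCol_leadSum hn, h', firstCol_leadSum, map_add, ddSum, Finsupp.weight_single,
      Finsupp.weight_single, one_smul, one_smul]
  have hk : kapSum a = kap x + kap y := by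
    rw [kapSum_eq a ⟨0, hn⟩, h', ← kapSum_eq, map_add, kapSum, Finsupp.weight_single,
      Finsupp.weight_single, one_smul, one_smul]
  obtain ⟨o, w, rfl, ho⟩ := exists_eq_of_degree_le_two h0 h2 ha
  rcases o with _ | z
  · simp only [Option.elim_none, zero_add, ddSum, kapSum, Finsupp.weight_single, one_smul] at hd hk
    exact absurd (isUXiPair_of_single hd hk) hp
  · simp only [Option.elim_some, ddSum, kapSum, map_add, Finsupp.weight_single, one_smul,
      leadSum_single] at hd hk h
    obtain ⟨e1, e2, e3⟩ := hle_of_lead_add_eq (x := x) (y := y) hn (ho z rfl) (by rw [add_comm, h])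
      (by rw [add_comm, hd]) (by rw [add_comm, hk])
    have l1 := rho_lt_of_hle hn e1 fun e => hxy (by rw [← e]; exact e2)
    have l2 := rho_lt_of_hle hn e2 fun e => hyx (by rw [← e]; exact e1)
    simp only [Option.elim_some, map_add, defectSum_single]
    have d1 := defect_add x
    have d2 := defect_add y
    have d3 := defect_add z
    have d4 := defect_add w
    zify at *
    nlinarith [mul_pos (sub_pos.2 l1) (sub_pos.2 l2)]

theorem lead_pairOfUXi (hn : 0 < n) (I : IncTup n m) (J : IncTup n q) :
    lead (pairOfUXi hn I J) = lead (Sum.inl I : HElt n m q) + lead (Sum.inr (Sum.inl J)) := by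
  ext (⟨i, j⟩ | ⟨j, l⟩)
  · rw [Finsupp.add_apply, lead_inl, lead_inl, lead_inl]
    change _ = ind m (rowv _) i j + ind m 0 i j
    rw [ind_zero, add_zero]
    rfl
  · rw [Finsupp.add_apply, lead_inr, lead_inr, lead_inr]
    change _ = ind q 0 l j + ind q (colv _) l j
    rw [ind_zero, zero_add]
    rfl

theorem defect_pairOfUXi_lt (hn : 0 < n) (I : IncTup n m) (J : IncTup n q) :
    defect (pairOfUXi hn I J) < defect (Sum.inl I : HElt n m q) +
      defect (Sum.inr (Sum.inl J) : HElt n m q) := by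
  have h : rho (pairOfUXi hn I J) = rho (Sum.inl I : HElt n m q) +
      rho (Sum.inr (Sum.inl J) : HElt n m q) := by
    rw [rho, rho, rho, ← Finset.sum_add_distrib]
    refine Finset.sum_congr rfl fun j _ => ?_
    simp [rowv, colv, pairOfUXi]
  have d1 := defect_add (pairOfUXi hn I J)
  have d2 := defect_add (Sum.inl I : HElt n m q)
  have d3 := defect_add (Sum.inr (Sum.inl J) : HElt n m q)
  have hR : 0 < (n * (m + q + 2)) ^ 2 := by positivity
  rw [h] at d1
  nlinarith [Nat.zero_le (rho (Sum.inl I : HElt n m q) * rho (Sum.inr (Sum.inl J) : HElt n m q))]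

end Termination

section Reduction

variable {K : Type} [Field K] {n m q : ℕ}

/-- Modulo the straightening relations every monomial is a combination of standard ones. -/
theorem monomial_mem_sup (hn : 0 < n) (J : Ideal (MvPolynomial (HElt n m q) K))
    (h1 : ∀ (I : IncTup n m) (I' : IncTup n q),
      X (Sum.inl I) * X (Sum.inr (Sum.inl I')) - X (pairOfUXi hn I I') ∈ J)
    (h2 : ∀ x y, ¬ hle x y → ¬ hle y x → ¬ isUXiPair x y → X x * X y - strF K hn x y ∈ J)
    (b : HElt n m q →₀ ℕ) :
    monomial b 1 ∈ restrictSupport K {a : HElt n m q →₀ ℕ | Std a} ⊔ J.restrictScalars K := by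
  classical
  induction hb : toLex (ord.toSyn (leadSum b), defectSum b)
    using WellFoundedLT.induction generalizing b with
  | _ t ih =>
    by_cases hs : Std b
    · exact Submodule.mem_sup_left ((monomial_mem_restrictSupport K).2 (Or.inl hs))
    -- replacing the product of two generators modulo `J`
    have key : ∀ (x y : HElt n m q) (c : HElt n m q →₀ ℕ) (F : MvPolynomial (HElt n m q) K),
        b = c + (Finsupp.single x 1 + Finsupp.single y 1) → X x * X y - F ∈ J →
        (∀ a ∈ F.support, ord.toSyn (leadSum a) ≤ ord.toSyn (lead x + lead y) ∧
          (leadSum a = lead x + lead y → defectSum a < defect x + defect y)) →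
        monomial b 1 ∈ restrictSupport K {a : HElt n m q →₀ ℕ | Std a} ⊔
          J.restrictScalars K := by
      intro x y c F hbc hJ hF
      have e : (monomial b 1 : MvPolynomial (HElt n m q) K) =
          monomial c 1 * (X x * X y - F) + monomial c 1 * F := by
        rw [← mul_add, sub_add_cancel, X, X, monomial_mul, monomial_mul, hbc]
        simp
      rw [e]
      refine Submodule.add_mem _ (Submodule.mem_sup_right (J.mul_mem_left _ hJ)) ?_
      rw [show monomial c 1 * F = ∑ a ∈ F.support, monomial c 1 * monomial a (coeff a F) by
        rw [← Finset.mul_sum, ← F.as_sum]]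
      refine Submodule.sum_mem _ fun a ha => ?_
      rw [monomial_mul, one_mul, ← mul_one (coeff a F), ← smul_eq_mul, ← smul_monomial]
      refine Submodule.smul_mem _ _ (ih _ ?_ _ rfl)
      rw [← hb, hbc]
      obtain ⟨f1, f2⟩ := hF a ha
      simp only [map_add, leadSum_single, one_smul, defectSum_single, Prod.Lex.toLex_lt_toLex]
      rcases f1.lt_or_eq with f1 | f1
      · left
        rw [map_add] at f1
        exact add_lt_add_right f1 _
      · right
        rw [map_add] at f1
        refine ⟨by rw [f1], ?_⟩
        have := f2 (ord.toSyn.injective (by rw [f1, map_add]))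
        omega
    have pairCase : ∀ (I : IncTup n m) (I' : IncTup n q) (c : HElt n m q →₀ ℕ),
        b = c + (Finsupp.single (Sum.inl I) 1 + Finsupp.single (Sum.inr (Sum.inl I')) 1) →
        monomial b 1 ∈ restrictSupport K {a : HElt n m q →₀ ℕ | Std a} ⊔
          J.restrictScalars K := by
      intro I I' c hbc
      refine key _ _ c _ hbc (h1 I I') fun a ha => ?_
      rw [support_X, Finset.mem_singleton] at ha
      subst ha
      rw [leadSum_single, one_smul, lead_pairOfUXi, defectSum_single]
      exact ⟨le_rfl, fun _ => defect_pairOfUXi_lt hn I I'⟩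
    simp only [Std, not_forall, not_or] at hs
    obtain ⟨x, hx, y, hy, hxy, hyx⟩ := hs
    have hne : x ≠ y := by
      rintro rfl
      exact hxy (hle_refl hn x)
    have hle1 : Finsupp.single x 1 + Finsupp.single y 1 ≤ b := by
      intro z
      rw [Finsupp.mem_support_iff] at hx hy
      rw [Finsupp.add_apply, Finsupp.single_apply, Finsupp.single_apply]
      split_ifs with e1 e2 e2
      · exact absurd (e1.trans e2.symm) hne
      · subst e1; omega
      · subst e2; omega
      · omega
    obtain ⟨c, hc⟩ := exists_add_of_le hle1
    rw [add_comm] at hc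
    by_cases hp : isUXiPair x y
    · rcases hp with ⟨I, I', rfl, rfl⟩ | ⟨I, I', rfl, rfl⟩
      · exact pairCase I I' c hc
      · exact pairCase I I' c (by rw [hc, add_comm (Finsupp.single (Sum.inl I) 1)])
    · refine key x y c _ hc (h2 x y hxy hyx hp) fun a ha => ?_
      obtain ⟨s1, s2, s3, s4⟩ := strF_support hn x y a ha
      exact ⟨s4, defectSum_lt hn hxy hyx hp s1 s2 s3⟩

theorem mem_of_piSL_eq_zero (hn : 0 < n) (J : Ideal (MvPolynomial (HElt n m q) K))
    (hJ : J ≤ RingHom.ker (piSL K n m q))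
    (h1 : ∀ (I : IncTup n m) (I' : IncTup n q),
      X (Sum.inl I) * X (Sum.inr (Sum.inl I')) - X (pairOfUXi hn I I') ∈ J)
    (h2 : ∀ x y, ¬ hle x y → ¬ hle y x → ¬ isUXiPair x y → X x * X y - strF K hn x y ∈ J) :
    RingHom.ker (piSL K n m q) ≤ J := by
  intro F hF
  have : F ∈ restrictSupport K {a : HElt n m q →₀ ℕ | Std a} ⊔ J.restrictScalars K := by
    rw [F.as_sum]
    refine Submodule.sum_mem _ fun a _ => ?_
    rw [← mul_one (coeff a F), ← smul_eq_mul, ← smul_monomial]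
    exact Submodule.smul_mem _ _ (monomial_mem_sup hn J h1 h2 a)
  obtain ⟨G, hG, H, hH, rfl⟩ := Submodule.mem_sup.1 this
  have hH' : H ∈ J := hH
  rw [RingHom.mem_ker, map_add, RingHom.mem_ker.1 (hJ hH'), add_zero] at hF
  rw [eq_zero_of_piSL_eq_zero hn (fun a ha => (mem_restrictSupport_iff K).1 hG ha) hF, zero_add]
  exact hH'

theorem uPoly_mul_xiPoly (I : Fin n → Fin m) (J : Fin n → Fin q) :
    uPoly K n m q I * xiPoly K n m q J =
      Matrix.det (Matrix.of fun i j : Fin n => (Ugen K n m q * Wgen K n m q) (I i) (J j)) := by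
  rw [uPoly, xiPoly, ← Matrix.det_mul]
  rfl

end Reduction

end SMB

open SMB in
/-- **Second fundamental theorem for `SL_n(K)`-invariants (presentation).**
The kernel of `π : K[X(A,B), Y(I), Z(J)] → K[X]^{SL_n(K)}` is generated by the quadratic
elements `Y(I)Z(J) − X(I,J)` together with one straightening element for each noncomparable
pair of elements of `H` which is not a pair `{I, J}` with `I ∈ H_u`, `J ∈ H_ξ`. -/
theorem sl_second_fundamental_theorem (K : Type) [Field K] [IsAlgClosed K]
    (n m q : ℕ) (hn : 0 < n) (hm : n < m) (hq : n < q) :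
    ∃ str : HElt n m q → HElt n m q → MvPolynomial (HElt n m q) K,
      (∀ α β : HElt n m q, ¬ hle α β → ¬ hle β α → ¬ isUXiPair α β →
        SLStraightElt K α β (str α β)) ∧
      RingHom.ker (piSL K n m q) =
        Ideal.span
          ({F | ∃ (I : IncTup n m) (J : IncTup n q),
              F = MvPolynomial.X (Sum.inl I : HElt n m q) *
                    MvPolynomial.X (Sum.inr (Sum.inl J) : HElt n m q) -
                  MvPolynomial.X (pairOfUXi hn I J)} ∪
           {F | ∃ α β : HElt n m q,
              ¬ hle α β ∧ ¬ hle β α ∧ ¬ isUXiPair α β ∧ F = str α β}) := by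
  refine ⟨fun α β => MvPolynomial.X α * MvPolynomial.X β - strF K hn α β,
    fun α β _ _ _ => straightElt_strF hn α β, ?_⟩
  refine le_antisymm (mem_of_piSL_eq_zero hn _ ?_ ?_ ?_) ?_
  rotate_left
  · exact fun I J => Ideal.subset_span (Or.inl ⟨I, J, rfl⟩)
  · exact fun α β h1 h2 h3 => Ideal.subset_span (Or.inr ⟨α, β, h1, h2, h3, rfl⟩)
  all_goals
    rw [Ideal.span_le]
    rintro F (⟨I, J, rfl⟩ | ⟨α, β, -, -, -, rfl⟩) <;> rw [SetLike.mem_coe, RingHom.mem_ker, map_sub, map_mul]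
    · rw [piSL, MvPolynomial.aeval_X, MvPolynomial.aeval_X, MvPolynomial.aeval_X, sub_eq_zero]
      exact uPoly_mul_xiPoly I.f J.f
    · rw [piSL_strF, piSL, MvPolynomial.aeval_X, MvPolynomial.aeval_X, sub_self]
end

section
/- The ring of invariants K[X]^{SL_n(K)} is a normal domain of Krull dimension (m+q)n − n² + 1; that is, it is an integral domain, it is integrally closed in its field of fractions, and its Krull dimension equals (m+q)n − n² + 1. -/
namespace SMB

variable (K : Type) [Field K] (n m q : ℕ)

/-- The ring of invariants `K[X]^{SL_n(K)}`, as a subalgebra of `K[X]`. -/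
noncomputable def slInvariants : Subalgebra K (KX K n m q) where
  carrier := {f | IsSLInvariant f}
  mul_mem' := by
    intro a b ha hb A U W
    rw [map_mul, map_mul, ha A U W, hb A U W]
  one_mem' := by intro A U W; rw [map_one, map_one]
  add_mem' := by
    intro a b ha hb A U W
    rw [map_add, map_add, ha A U W, hb A U W]
  zero_mem' := by intro A U W; rw [map_zero, map_zero]
  algebraMap_mem' := by
    intro c A U W
    simp only [MvPolynomial.algebraMap_eq, evalX, MvPolynomial.eval_C]

end SMB

section KrullDimension

/-- The target of an integral ring homomorphism has dimension at most that of the source. -/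
theorem ringKrullDim_le_of_isIntegral {R S : Type*} [CommRing R] [CommRing S] (g : R →+* S)
    (hg : g.IsIntegral) : ringKrullDim S ≤ ringKrullDim R := by
  algebraize [g]
  refine Order.krullDim_le_of_strictMono (PrimeSpectrum.comap (algebraMap R S)) fun p p' h => ?_
  exact Ideal.IsIntegral.comap_lt_comap h

/-- A domain that embeds in a polynomial ring over a field has dimension at most the number of
variables. -/
theorem ringKrullDim_le_of_injective_mvPolynomial {K : Type*} [Field K] {A : Type*} [CommRing A]
    [Algebra K A] {σ : Type*} [Finite σ] (ρ : A →ₐ[K] MvPolynomial σ K)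
    (hρ : Function.Injective ρ) : ringKrullDim A ≤ Nat.card σ := by
  refine iSup_le fun p => ?_
  have hlt (i : Fin p.length) : (p i.castSucc).asIdeal < (p i.succ).asIdeal := p.step i
  choose x hx hx' using fun i => SetLike.exists_of_lt (hlt i)
  let B := Algebra.adjoin K (Set.range x)
  have hfg : Algebra.FiniteType K B :=
    (Subalgebra.fg_iff_finiteType _).mp (Subalgebra.fg_def.mpr ⟨_, Set.finite_range x, rfl⟩)
  have : Nontrivial A := ρ.toRingHom.domain_nontrivial
  have hpB : (p.length : WithBot ℕ∞) ≤ ringKrullDim B := by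
    let P : Fin (p.length + 1) → PrimeSpectrum B :=
      fun i => PrimeSpectrum.comap (algebraMap B A) (p i)
    have hP : StrictMono P := by
      refine Fin.strictMono_iff_lt_succ.mpr fun i => lt_of_le_not_ge ?_ fun h => ?_
      · exact Ideal.comap_mono (hlt i).le
      · have hxB : x i ∈ B := Algebra.subset_adjoin ⟨i, rfl⟩
        exact hx' i (h (show (⟨x i, hxB⟩ : B) ∈ (P i.succ).asIdeal from hx i))
    exact Order.LTSeries.length_le_krullDim (LTSeries.mk p.length P hP)
  obtain ⟨s, g, hg, hgi⟩ := exists_integral_inj_algHom_of_fg K B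
  have hs : s ≤ Nat.card σ := by
    have hinj : Function.Injective ((ρ.comp B.val).comp g) :=
      (hρ.comp Subtype.val_injective).comp hg
    have := lift_trdeg_le_of_injective _ hinj
    have hfin := Fintype.ofFinite σ
    simpa [MvPolynomial.trdeg_of_isDomain] using this
  calc (p.length : WithBot ℕ∞) ≤ ringKrullDim B := hpB
    _ ≤ ringKrullDim (MvPolynomial (Fin s) K) := ringKrullDim_le_of_isIntegral _ hgi
    _ = s := by simp [MvPolynomial.ringKrullDim_of_isNoetherianRing]
    _ ≤ Nat.card σ := by exact_mod_cast hs

/-- If the image of `A` in a polynomial ring contains every variable up to multiplication by a power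
of one fixed variable, then `A` has dimension at least the number of variables. -/
theorem card_le_ringKrullDim_of_mvPolynomial {K : Type*} [Field K] {A : Type*} [CommRing A]
    {τ : Type*} [Finite τ] (ρ : A →+* MvPolynomial (Option τ) K)
    (h : ∀ s, ∃ a e, ρ a = MvPolynomial.X s * MvPolynomial.X none ^ e) :
    (Nat.card (Option τ) : WithBot ℕ∞) ≤ ringKrullDim A := by
  let E := Finite.equivFin τ
  let rank : Option τ → ℕ := fun s => s.elim (Nat.card τ) fun t => E t
  have hsurj (i : ℕ) (hi : i ≤ Nat.card τ) : ∃ s, rank s = i := by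
    rcases hi.eq_or_lt with rfl | hi
    · exact ⟨none, rfl⟩
    · exact ⟨some (E.symm ⟨i, hi⟩), by simp [rank]⟩
  let sub (k : ℕ) : MvPolynomial (Option τ) K →ₐ[K] MvPolynomial (Option τ) K :=
    MvPolynomial.aeval fun s => if rank s < k then 0 else MvPolynomial.X s
  have hsub (k : ℕ) : (sub (k + 1)).comp (sub k) = sub (k + 1) := by
    ext1 s
    by_cases hs : rank s < k
    · simp [sub, hs, hs.le]
    · simp [sub, hs]
  let P : Fin (Nat.card τ + 1 + 1) → PrimeSpectrum A := fun k =>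
    ⟨RingHom.ker ((sub k).toRingHom.comp ρ), RingHom.ker_isPrime _⟩
  have hP : StrictMono P := by
    refine Fin.strictMono_iff_lt_succ.mpr fun i => lt_of_le_not_ge ?_ fun hle => ?_
    · intro a (ha : sub i (ρ a) = 0)
      change sub (i + 1) (ρ a) = 0
      rw [← hsub, AlgHom.comp_apply, ha, map_zero]
    · obtain ⟨s, hs⟩ := hsurj i (Nat.lt_succ_iff.mp i.isLt)
      obtain ⟨a, e, ha⟩ := h s
      have h1 : sub (i + 1) (ρ a) = 0 := by simp [sub, ha, hs]
      have h2 : sub i (ρ a) = 0 := hle h1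
      have h3 : ¬ rank none < (i : ℕ) := not_lt.mpr (Nat.lt_succ_iff.mp i.isLt)
      simp [sub, ha, hs, h3, MvPolynomial.X_ne_zero] at h2
  have := Order.LTSeries.length_le_krullDim (LTSeries.mk _ P hP)
  simpa [Finite.card_option, ringKrullDim] using this

end KrullDimension

/-- A subalgebra of a normal domain that is closed under exact division is normal. -/
theorem Subalgebra.isIntegrallyClosed_of_mul_mem {K R : Type*} [CommRing K] [CommRing R]
    [IsDomain R] [Algebra K R] [IsIntegrallyClosed R] (S : Subalgebra K R)
    (h : ∀ b ∈ S, b ≠ 0 → ∀ c, b * c ∈ S → c ∈ S) : IsIntegrallyClosed S := by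
  refine (isIntegrallyClosed_iff (FractionRing S)).mpr fun {x} hx => ?_
  obtain ⟨a, b, hb, rfl⟩ := IsFractionRing.div_surjective (A := S) x
  have hinj : Function.Injective (algebraMap S R) := Subtype.val_injective
  let ψ : FractionRing S →+* FractionRing R := IsFractionRing.map hinj
  have hψ (s : S) : ψ (algebraMap S _ s) = algebraMap R _ (s : R) := IsLocalization.map_eq _ _
  have hint : IsIntegral R (ψ (algebraMap S _ a / algebraMap S _ b)) :=
    hx.map_of_comp_eq (algebraMap S R) ψ (RingHom.ext fun s => (hψ s).symm)
  obtain ⟨c, hc⟩ := (isIntegrallyClosed_iff (FractionRing R)).mp inferInstance hint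
  have hb0 : b ≠ 0 := nonZeroDivisors.ne_zero hb
  have hbR : (b : R) ≠ 0 := fun h0 => hb0 (Subtype.ext h0)
  have hbF : algebraMap R (FractionRing R) b ≠ 0 := by simpa using hbR
  have hbS : algebraMap S (FractionRing S) b ≠ 0 := by simpa using hb0
  rw [map_div₀, hψ, hψ, eq_div_iff hbF, ← map_mul] at hc
  have hbc : (b : R) * c = a := by rw [mul_comm]; exact IsFractionRing.injective R _ hc
  have hcS : c ∈ S := h b b.2 hbR c (hbc ▸ a.2)
  refine ⟨⟨c, hcS⟩, ?_⟩
  rw [eq_div_iff hbS, ← map_mul]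
  congr 1
  exact Subtype.ext (by rw [mul_comm]; exact hbc)

namespace SMB

section Invariants

variable {K : Type} [Field K] {n m q : ℕ}

theorem evalX_Ugen (U : Matrix (Fin m) (Fin n) K) (W : Matrix (Fin n) (Fin q) K) (i : Fin m)
    (k : Fin n) : evalX K n m q U W (Ugen K n m q i k) = U i k := by
  simp [evalX, Ugen]

theorem evalX_Wgen (U : Matrix (Fin m) (Fin n) K) (W : Matrix (Fin n) (Fin q) K) (k : Fin n)
    (j : Fin q) : evalX K n m q U W (Wgen K n m q k j) = W k j := by
  simp [evalX, Wgen]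

theorem evalX_ext [Infinite K] {f g : KX K n m q}
    (h : ∀ U W, evalX K n m q U W f = evalX K n m q U W g) : f = g := by
  refine MvPolynomial.funext fun x => ?_
  have hx : x = Sum.elim (fun p => Matrix.of (fun i k => x (Sum.inl (i, k))) p.1 p.2)
      (fun p => Matrix.of (fun k j => x (Sum.inr (k, j))) p.1 p.2) := by
    ext (_ | _) <;> rfl
  rw [hx]
  exact h _ _

theorem phi_mem_slInvariants (i : Fin m) (j : Fin q) : phi K n m q i j ∈ slInvariants K n m q := by
  have key (U : Matrix (Fin m) (Fin n) K) (W : Matrix (Fin n) (Fin q) K) :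
      evalX K n m q U W (phi K n m q i j) = (U * W) i j := by
    simp [phi, Matrix.mul_apply, evalX_Ugen, evalX_Wgen]
  intro A U W
  rw [key, key, Matrix.mul_assoc, ← Matrix.mul_assoc (A : Matrix (Fin n) (Fin n) K),
    ← Matrix.SpecialLinearGroup.coe_mul, mul_inv_cancel, Matrix.SpecialLinearGroup.coe_one,
    Matrix.one_mul]

theorem evalX_det_Ugen (r : Fin n → Fin m) (U : Matrix (Fin m) (Fin n) K)
    (W : Matrix (Fin n) (Fin q) K) :
    evalX K n m q U W ((Ugen K n m q).submatrix r id).det = (U.submatrix r id).det := by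
  rw [RingHom.map_det]
  congr 1
  ext i k
  exact evalX_Ugen U W _ _

theorem det_Ugen_mem_slInvariants (r : Fin n → Fin m) :
    ((Ugen K n m q).submatrix r id).det ∈ slInvariants K n m q := by
  intro A U W
  rw [evalX_det_Ugen, evalX_det_Ugen]
  have : (U * (A : Matrix (Fin n) (Fin n) K)).submatrix r id = U.submatrix r id * A.1 := rfl
  rw [this, Matrix.det_mul, A.2, mul_one]

theorem mem_slInvariants_of_mul_mem [Infinite K] {b c : KX K n m q}
    (hb : b ∈ slInvariants K n m q) (hb0 : b ≠ 0) (hbc : b * c ∈ slInvariants K n m q) :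
    c ∈ slInvariants K n m q := by
  intro A
  let act : KX K n m q →ₐ[K] KX K n m q := MvPolynomial.aeval (Sum.elim
    (fun p => ∑ l, Ugen K n m q p.1 l * MvPolynomial.C (A.1 l p.2))
    fun p => ∑ l, MvPolynomial.C ((A⁻¹).1 p.1 l) * Wgen K n m q l p.2)
  have hact (U W) : evalX K n m q U W (act c) = evalX K n m q (U * A.1) ((A⁻¹).1 * W) c := by
    have h : (evalX K n m q U W).comp act.toRingHom =
        evalX K n m q (U * A.1) ((A⁻¹).1 * W) := by
      refine MvPolynomial.ringHom_ext (fun r => ?_) fun s => ?_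
      · simp [evalX, act]
      · rcases s with ⟨i, k⟩ | ⟨k, j⟩
        · simp [evalX, act, Ugen, Matrix.mul_apply]
        · simp [evalX, act, Wgen, Matrix.mul_apply]
    exact DFunLike.congr_fun h c
  have hmul : b * act c = b * c := by
    refine evalX_ext fun U W => ?_
    have h := hbc A U W
    rw [map_mul, hb A U W, map_mul] at h
    rw [map_mul, map_mul, hact]
    exact h
  have hcc : act c = c := mul_left_cancel₀ hb0 hmul
  intro U W
  rw [← hcc, hact U W, hcc]

end Invariants

section Slice

variable (K : Type) [Field K] (n p q : ℕ)

/-- The matrix `diag(t, 1, …, 1)`, written with exponents. -/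
def sliceDiag {R : Type*} [CommRing R] (t : R) : Matrix (Fin n) (Fin n) R :=
  Matrix.diagonal fun j => t ^ (if (j : ℕ) = 0 then 1 else 0)

variable {n} in
theorem det_sliceDiag {R : Type*} [CommRing R] (hn : 0 < n) (t : R) :
    (sliceDiag n t).det = t := by
  obtain ⟨n, rfl⟩ := Nat.exists_eq_add_of_lt hn
  rw [sliceDiag, Matrix.det_diagonal, Finset.prod_pow_eq_pow_sum]
  rw [zero_add, Fin.sum_univ_succ]
  simp

/-- Variables on the slice of pairs `(U, W)` whose matrix `U` has first `n` rows
`diag(t, 1, …, 1)`. -/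
abbrev SliceVar := Option ((Fin p × Fin n) ⊕ (Fin n × Fin q))

/-- The restriction of polynomial functions to the slice. -/
noncomputable def sliceRestrict :
    KX K n (n + p) q →ₐ[K] MvPolynomial (SliceVar n p q) K :=
  MvPolynomial.aeval <| Sum.elim
    (fun x => Fin.addCases (fun i => sliceDiag n (MvPolynomial.X none) i x.2)
      (fun i => MvPolynomial.X (some (Sum.inl (i, x.2)))) x.1)
    fun x => MvPolynomial.X (some (Sum.inr x))

variable {K n p q}

theorem sliceRestrict_Ugen_castAdd (i k : Fin n) :
    sliceRestrict K n p q (Ugen K n (n + p) q (Fin.castAdd p i) k) =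
      sliceDiag n (MvPolynomial.X none) i k := by
  simp [sliceRestrict, Ugen]

theorem sliceRestrict_Ugen_natAdd (i : Fin p) (k : Fin n) :
    sliceRestrict K n p q (Ugen K n (n + p) q (Fin.natAdd n i) k) =
      MvPolynomial.X (some (Sum.inl (i, k))) := by
  simp [sliceRestrict, Ugen]

theorem sliceRestrict_Wgen (k : Fin n) (j : Fin q) :
    sliceRestrict K n p q (Wgen K n (n + p) q k j) = MvPolynomial.X (some (Sum.inr (k, j))) := by
  simp [sliceRestrict, Wgen]

theorem sliceRestrict_det (hn : 0 < n) :
    sliceRestrict K n p q ((Ugen K n (n + p) q).submatrix (Fin.castAdd p) id).det =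
      MvPolynomial.X none := by
  rw [AlgHom.map_det, ← det_sliceDiag hn (MvPolynomial.X none)]
  congr 1
  ext1 i k
  exact sliceRestrict_Ugen_castAdd i k

theorem sliceRestrict_phi (k : Fin n) (j : Fin q) :
    sliceRestrict K n p q (phi K n (n + p) q (Fin.castAdd p k) j) =
      MvPolynomial.X (some (Sum.inr (k, j))) *
        MvPolynomial.X none ^ (if (k : ℕ) = 0 then 1 else 0) := by
  rw [phi, Matrix.mul_apply, map_sum]
  simp only [map_mul, sliceRestrict_Ugen_castAdd, sliceRestrict_Wgen]
  rw [Finset.sum_eq_single k]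
  · rw [sliceDiag, Matrix.diagonal_apply_eq, mul_comm]
  · intro b _ hb
    rw [sliceDiag, Matrix.diagonal_apply_ne' _ hb, zero_mul]
  · simp

theorem sliceRestrict_det_update (i : Fin p) (k : Fin n) :
    ∃ e, sliceRestrict K n p q ((Ugen K n (n + p) q).submatrix
      (Function.update (Fin.castAdd p) k (Fin.natAdd n i)) id).det =
      MvPolynomial.X (some (Sum.inl (i, k))) * MvPolynomial.X none ^ e := by
  have h : (sliceRestrict K n p q).mapMatrix ((Ugen K n (n + p) q).submatrix
      (Function.update (Fin.castAdd p) k (Fin.natAdd n i)) id) =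
      (sliceDiag n (MvPolynomial.X none)).updateRow k
        fun k => MvPolynomial.X (some (Sum.inl (i, k))) := by
    ext1 a b
    by_cases hak : a = k
    · subst hak
      simp [sliceRestrict_Ugen_natAdd]
    · simp [hak, sliceRestrict_Ugen_castAdd]
  rw [AlgHom.map_det, h, ← Matrix.cramer_transpose_apply, sliceDiag, Matrix.diagonal_transpose,
    Matrix.cramer_eq_adjugate_mulVec, Matrix.adjugate_diagonal, Matrix.mulVec_diagonal,
    Finset.prod_pow_eq_pow_sum]
  exact ⟨_, mul_comm _ _⟩

/-- The matrix with first `n` rows `diag(t, 1, …, 1)` and last `p` rows `V`. -/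
def sliceMatrix (t : K) (V : Matrix (Fin p) (Fin n) K) : Matrix (Fin (n + p)) (Fin n) K :=
  Matrix.of fun i k => Fin.addCases (fun i => sliceDiag n t i k) (fun i => V i k) i

theorem eval_sliceRestrict (t : K) (V : Matrix (Fin p) (Fin n) K) (W : Matrix (Fin n) (Fin q) K)
    (f : KX K n (n + p) q) :
    MvPolynomial.eval (fun s : SliceVar n p q =>
        s.elim t (Sum.elim (fun x => V x.1 x.2) fun x => W x.1 x.2))
      (sliceRestrict K n p q f) =
    evalX K n (n + p) q (sliceMatrix t V) W f := by
  have h : (MvPolynomial.eval (fun s : SliceVar n p q =>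
        s.elim t (Sum.elim (fun x => V x.1 x.2) fun x => W x.1 x.2))).comp
      (sliceRestrict K n p q).toRingHom =
      evalX K n (n + p) q (sliceMatrix t V) W := by
    refine MvPolynomial.ringHom_ext (fun r => ?_) fun s => ?_
    · simp [evalX]
    · rcases s with ⟨i, k⟩ | ⟨k, j⟩
      · induction i using Fin.addCases with
        | left i =>
          by_cases hik : i = k
          · subst hik
            by_cases hi : (i : ℕ) = 0 <;>
              simp [evalX, sliceRestrict, sliceDiag, sliceMatrix, hi]
          · simp [evalX, sliceRestrict, sliceDiag, sliceMatrix, hik]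
        | right i => simp [evalX, sliceRestrict, sliceMatrix]
      · simp [evalX, sliceRestrict]
  exact DFunLike.congr_fun h f

/-- Where the top `n × n` minor of `U` does not vanish, some element of `SL_n(K)` moves `(U, W)`
into the slice. -/
theorem evalX_eq_eval_sliceRestrict (hn : 0 < n) {f : KX K n (n + p) q}
    (hf : f ∈ slInvariants K n (n + p) q) (U : Matrix (Fin (n + p)) (Fin n) K)
    (W : Matrix (Fin n) (Fin q) K) (hU : (U.submatrix (Fin.castAdd p) id).det ≠ 0) :
    ∃ x, evalX K n (n + p) q U W f = MvPolynomial.eval x (sliceRestrict K n p q f) := by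
  set U₁ := U.submatrix (Fin.castAdd p) id
  let A : Matrix.SpecialLinearGroup (Fin n) K := ⟨U₁⁻¹ * sliceDiag n U₁.det, by
    rw [Matrix.det_mul, Matrix.det_nonsing_inv, det_sliceDiag hn, Ring.inverse_mul_cancel _
      (isUnit_iff_ne_zero.mpr hU)]⟩
  have hUA : U * A.1 = sliceMatrix U₁.det fun i => (U * A.1) (Fin.natAdd n i) := by
    ext i k
    induction i using Fin.addCases with
    | left i =>
      have h : U₁ * A.1 = sliceDiag n U₁.det :=
        Matrix.mul_nonsing_inv_cancel_left _ _ (isUnit_iff_ne_zero.mpr hU)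
      exact (congrFun (congrFun h i) k).trans (by simp [sliceMatrix])
    | right i => simp [sliceMatrix]
  have h := eval_sliceRestrict U₁.det (fun i => (U * A.1) (Fin.natAdd n i)) ((A⁻¹).1 * W) f
  rw [← hUA] at h
  exact ⟨_, (hf A U W).symm.trans h.symm⟩

theorem sliceRestrict_injective [Infinite K] (hn : 0 < n) :
    Function.Injective ((sliceRestrict K n p q).comp (slInvariants K n (n + p) q).val) := by
  refine (injective_iff_map_eq_zero _).mpr fun f hf => Subtype.ext ?_
  have hdet : ((Ugen K n (n + p) q).submatrix (Fin.castAdd p) id).det ≠ 0 := fun h0 => by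
    have h := sliceRestrict_det (K := K) (p := p) (q := q) hn
    rw [h0, map_zero] at h
    exact MvPolynomial.X_ne_zero _ h.symm
  refine (mul_eq_zero.mp (?_ : (f : KX K n (n + p) q) * _ = 0)).resolve_right hdet
  refine evalX_ext fun U W => ?_
  rw [map_mul, evalX_det_Ugen, map_zero]
  by_cases hU : (U.submatrix (Fin.castAdd p) id).det = 0
  · rw [hU, mul_zero]
  · obtain ⟨x, hx⟩ := evalX_eq_eval_sliceRestrict hn f.2 U W hU
    have hf' : sliceRestrict K n p q f = 0 := hf
    rw [hx, hf', map_zero, zero_mul]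

theorem ringKrullDim_slInvariants [Infinite K] (hn : 0 < n) :
    ringKrullDim (slInvariants K n (n + p) q) = Nat.card (SliceVar n p q) := by
  refine le_antisymm (ringKrullDim_le_of_injective_mvPolynomial _ (sliceRestrict_injective hn)) ?_
  refine card_le_ringKrullDim_of_mvPolynomial
    ((sliceRestrict K n p q).comp (slInvariants K n (n + p) q).val).toRingHom fun s => ?_
  rcases s with _ | ⟨i, k⟩ | ⟨k, j⟩
  · exact ⟨⟨_, det_Ugen_mem_slInvariants _⟩, 0,
      (sliceRestrict_det hn).trans (by rw [pow_zero, mul_one])⟩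
  · obtain ⟨e, he⟩ := sliceRestrict_det_update (K := K) (q := q) i k
    exact ⟨⟨_, det_Ugen_mem_slInvariants _⟩, e, he⟩
  · exact ⟨⟨_, phi_mem_slInvariants _ _⟩, _, sliceRestrict_phi k j⟩

end Slice

end SMB

open SMB in
/-- **`K[X]^{SL_n(K)}` is a normal domain of dimension `(m+q)n − n² + 1`.**
The ring of invariants is an integral domain, is integrally closed in its field of
fractions, and its Krull dimension is `(m+q)n − n² + 1`. -/
theorem sl_invariants_normal_domain (K : Type) [Field K] [IsAlgClosed K]
    (n m q : ℕ) (hn : 0 < n) (hm : n < m) (hq : n < q) :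
    IsDomain (slInvariants K n m q) ∧
    IsIntegrallyClosed (slInvariants K n m q) ∧
    ringKrullDim (slInvariants K n m q) = ((m + q) * n - n ^ 2 + 1 : ℕ) := by
  have : Infinite K := IsAlgClosed.instInfinite
  refine ⟨inferInstance, Subalgebra.isIntegrallyClosed_of_mul_mem _
    fun b hb hb0 c hbc => mem_slInvariants_of_mul_mem hb hb0 hbc, ?_⟩
  obtain ⟨p, rfl⟩ := Nat.exists_eq_add_of_le hm.le
  rw [ringKrullDim_slInvariants hn]
  have hcard : Nat.card (SliceVar n p q) = (n + p + q) * n - n ^ 2 + 1 := by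
    have h : (n + p + q) * n = p * n + n * q + n ^ 2 := by ring
    rw [h, Nat.add_sub_cancel]
    simp [SliceVar]
  rw [hcard]
end
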